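/- arXiv:2306.16079 — 4 statements merged into one kernel-verified Lean document; each statement's English description precedes it below -/
import Mathlib

section
/- For every fixed integer $r \ge 0$ there exists a constant $K > 0$ such that for all $n \ge 1$: $\big| \mathbb{E}\big(\hat X_n^{\underline r}\big) - \tfrac{(r+1)!\, 8^{-r/2}}{\Gamma(r/2+1)}\, n^{r/2} \big| \le K\, n^{(r-1)/2}$, where $\hat X_n = X_n - n/2$ and $\mathbb{E}(\hat X_n^{\underline r}) = 2^{-n} \sum_{w \in \{a,b\}^n} (g(w) - n/2)(g(w) - n/2 - 1) \cdots (g(w) - n/2 - r + 1)$ is the $r$-th factorial moment. -/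
/-- Two-color majority-guessing correct count (`true = a`, `false = b`). -/
def chat : List Bool → ℕ
  | [] => 0
  | x :: w =>
      chat w + if decide ((x :: w).count true ≥ (x :: w).count false) = x then 1 else 0

/-- Riffle-shuffle correct-guess count. -/
def g : List Bool → ℕ
  | [] => 0
  | true :: w => 1 + g w
  | false :: w => if w = List.replicate w.length false then w.length + 1 else chat w

/-- The `r`-th factorial moment of `X̂_n = X_n - n/2`:
`E(X̂_n^{(r)}) = 2^{-n} ∑_w (g(w)-n/2)(g(w)-n/2-1)⋯(g(w)-n/2-r+1)`. -/
noncomputable def factMom (n r : ℕ) : ℝ :=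
  (∑ w : Fin n → Bool,
      ∏ i ∈ Finset.range r, ((g (List.ofFn w) : ℝ) - (n : ℝ) / 2 - (i : ℝ))) / 2 ^ n


namespace Riffle

/-! ### Asymptotic calculus -/

noncomputable def sq (n : ℕ) : ℝ := √((n : ℝ) + 1)

lemma sq_sq (n : ℕ) : sq n ^ 2 = n + 1 := Real.sq_sqrt (by positivity)

lemma one_le_sq (n : ℕ) : 1 ≤ sq n := by
  unfold sq
  rw [Real.one_le_sqrt]
  have : (0 : ℝ) ≤ n := by positivity
  linarith

lemma sq_pos (n : ℕ) : 0 < sq n := lt_of_lt_of_le one_pos (one_le_sq n)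

lemma sq_succ (n : ℕ) : sq (n + 1) ^ 2 = sq n ^ 2 + 1 := by
  rw [sq_sq, sq_sq]; push_cast; ring

/-- basic step estimates -/
lemma step_le {s t : ℝ} (hs : 1 ≤ s) (ht : 0 ≤ t) (h : t ^ 2 = s ^ 2 + 1) :
    s ≤ t ∧ t ≤ 2 * s := by
  constructor <;> nlinarith

lemma step_ge {s t : ℝ} (hs : 1 ≤ s) (ht : 0 ≤ t) (h : t ^ 2 = s ^ 2 + 1) :
    1 / (3 * s) ≤ t - s := by
  obtain ⟨h1, h2⟩ := step_le hs ht h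
  rw [div_le_iff₀ (by positivity)]
  nlinarith

lemma pow_diff (m : ℕ) : ∃ K : ℝ, 0 ≤ K ∧ ∀ s t : ℝ, 1 ≤ s → 0 ≤ t → t ^ 2 = s ^ 2 + 1 →
    |t ^ m - s ^ m - (m / 2 : ℝ) * (s ^ m / s ^ 2)| ≤ K * (s ^ m / s ^ 3) := by
  induction m using Nat.twoStepInduction with
  | zero => exact ⟨0, le_rfl, fun s t _ _ _ => by simp⟩
  | one =>
    refine ⟨1, zero_le_one, fun s t hs ht h => ?_⟩
    obtain ⟨h1, h2⟩ := step_le hs ht h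
    have h0 : 0 < s := by linarith
    have e1 : t ^ 1 - s ^ 1 - ((1 : ℕ) / 2 : ℝ) * (s ^ 1 / s ^ 2)
        = (2 * s * (t - s) - 1) / (2 * s) := by
      push_cast; field_simp
    have e2 : 2 * s * (t - s) - 1 = - (t - s) ^ 2 := by nlinarith
    have e3 : 1 * (s ^ 1 / s ^ 3) = (2 / s) / (2 * s) := by field_simp
    have h3 : (t - s) ≤ 1 / s := by
      rw [le_div_iff₀ h0]; nlinarith
    rw [e1, e2, e3, abs_div, abs_neg, abs_of_nonneg (sq_nonneg _), abs_of_pos (by positivity : 0 < 2 * s)]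
    gcongr
    have h4 : 1 / s ≤ 1 := by rw [div_le_one h0]; exact hs
    have h5 : 2 / s = 2 * (1 / s) := by ring
    rw [h5]
    nlinarith
  | more m ih _ =>
    obtain ⟨K, hK, H⟩ := ih
    refine ⟨2 * K + m / 2, by positivity, fun s t hs ht h => ?_⟩
    have h0 : 0 < s := by linarith
    have H1 := H s t hs ht h
    set x := s ^ m with hx
    have hxp : 0 < x := by positivity
    have e1 : t ^ (m + 2) - s ^ (m + 2) - ((m + 2 : ℕ) / 2 : ℝ) * (s ^ (m + 2) / s ^ 2)
        = (s ^ 2 + 1) * (t ^ m - x - (m / 2 : ℝ) * (x / s ^ 2)) + (m / 2 : ℝ) * (x / s ^ 2) := by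
      rw [pow_add, pow_add, h, ← hx]; push_cast; field_simp; ring
    have e2 : s ^ (m + 2) / s ^ 3 = x / s := by
      rw [pow_add, ← hx]; field_simp
    have h2 : x / s ^ 2 ≤ x / s := by
      gcongr; nlinarith
    rw [e1, e2]
    refine (abs_add_le _ _).trans ?_
    rw [abs_mul, abs_of_pos (by positivity : 0 < s ^ 2 + 1),
      abs_of_nonneg (by positivity : 0 ≤ (m / 2 : ℝ) * (x / s ^ 2))]
    have h3 : (s ^ 2 + 1) * |t ^ m - x - (m / 2 : ℝ) * (x / s ^ 2)| ≤ 2 * K * (x / s) := by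
      calc _ ≤ (s ^ 2 + s ^ 2) * (K * (x / s ^ 3)) := by
            gcongr; nlinarith
        _ = _ := by field_simp; ring
    have h4 : (m / 2 : ℝ) * (x / s ^ 2) ≤ m / 2 * (x / s) := by gcongr
    linarith

lemma pow_diff' (m : ℕ) : ∃ K : ℝ, 0 ≤ K ∧ ∀ s t : ℝ, 1 ≤ s → 0 ≤ t → t ^ 2 = s ^ 2 + 1 →
    |t ^ m - s ^ m| ≤ K * (s ^ m / s) := by
  obtain ⟨K, hK, H⟩ := pow_diff m
  refine ⟨K + m / 2, by positivity, fun s t hs ht h => ?_⟩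
  have h0 : 0 < s := by linarith
  have H1 := H s t hs ht h
  have h2 : s ^ m / s ^ 2 ≤ s ^ m / s := by
    gcongr; nlinarith
  have h3 : s ^ m / s ^ 3 ≤ s ^ m / s := by
    gcongr; nlinarith [sq_nonneg (s - 1)]
  have e : t ^ m - s ^ m = (t ^ m - s ^ m - (m / 2 : ℝ) * (s ^ m / s ^ 2))
    + (m / 2 : ℝ) * (s ^ m / s ^ 2) := by ring
  rw [e]
  refine (abs_add_le _ _).trans ?_
  rw [abs_of_nonneg (by positivity : 0 ≤ (m / 2 : ℝ) * (s ^ m / s ^ 2))]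
  have h4 : K * (s ^ m / s ^ 3) ≤ K * (s ^ m / s) := by gcongr
  have h5 : (m / 2 : ℝ) * (s ^ m / s ^ 2) ≤ m / 2 * (s ^ m / s) := by gcongr
  linarith

/-- `u n = c (n+1)^(p/2) + O((n+1)^((p-1)/2))`. -/
def Asy (p : ℕ) (u : ℕ → ℝ) (c : ℝ) : Prop :=
  ∃ K : ℝ, ∀ n, |u n - c * sq n ^ p| ≤ K * (sq n ^ p / sq n)

lemma err_pos (p n : ℕ) : 0 < sq n ^ p / sq n := by
  have := sq_pos n; positivity

lemma Asy.zero (p : ℕ) : Asy p (fun _ => 0) 0 := ⟨0, fun n => by simp⟩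

lemma Asy.add {p : ℕ} {u v : ℕ → ℝ} {c d : ℝ} (hu : Asy p u c) (hv : Asy p v d) :
    Asy p (fun n => u n + v n) (c + d) := by
  obtain ⟨K, hK⟩ := hu
  obtain ⟨L, hL⟩ := hv
  refine ⟨K + L, fun n => ?_⟩
  have e : u n + v n - (c + d) * sq n ^ p = (u n - c * sq n ^ p) + (v n - d * sq n ^ p) := by ring
  rw [e]
  refine (abs_add_le _ _).trans ?_
  linarith [hK n, hL n]

lemma Asy.const_mul {p : ℕ} {u : ℕ → ℝ} {c : ℝ} (a : ℝ) (hu : Asy p u c) :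
    Asy p (fun n => a * u n) (a * c) := by
  obtain ⟨K, hK⟩ := hu
  refine ⟨|a| * K, fun n => ?_⟩
  have e : a * u n - a * c * sq n ^ p = a * (u n - c * sq n ^ p) := by ring
  rw [e, abs_mul, mul_assoc]
  exact mul_le_mul_of_nonneg_left (hK n) (abs_nonneg a)

lemma Asy.sum {p : ℕ} {ι : Type*} (I : Finset ι) (u : ι → ℕ → ℝ) (c : ι → ℝ)
    (h : ∀ i ∈ I, Asy p (u i) (c i)) :
    Asy p (fun n => ∑ i ∈ I, u i n) (∑ i ∈ I, c i) := by
  classical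
  induction I using Finset.induction_on with
  | empty => simpa using Asy.zero p
  | insert a s ha ih =>
    simp only [Finset.sum_insert ha]
    exact (h a (by simp)).add (ih fun i hi => h i (by simp [hi]))

lemma Asy.congr {p : ℕ} {u v : ℕ → ℝ} {c d : ℝ} (hu : Asy p u c) (h : ∀ n, u n = v n)
    (hc : c = d) : Asy p v d := by
  have : u = v := funext h
  rw [← this, ← hc]; exact hu

lemma Asy.of_bdd {p : ℕ} (hp : 1 ≤ p) {u : ℕ → ℝ} {K : ℝ} (h : ∀ n, |u n| ≤ K) : Asy p u 0 := by
  refine ⟨K, fun n => ?_⟩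
  have h1 : 1 ≤ sq n ^ p / sq n := by
    rw [one_le_div (sq_pos n)]
    exact le_self_pow₀ (one_le_sq n) (by omega)
  have h2 : 0 ≤ K := (abs_nonneg _).trans (h 0)
  have := h n
  simp only [zero_mul, sub_zero]
  nlinarith

lemma Asy.lower {p q : ℕ} (hpq : p < q) {u : ℕ → ℝ} {c : ℝ} (h : Asy p u c) : Asy q u 0 := by
  obtain ⟨K, hK⟩ := h
  refine ⟨|c| + |K|, fun n => ?_⟩
  have hs := sq_pos n
  have h1 := one_le_sq n
  have e1 : sq n ^ p ≤ sq n ^ q / sq n := by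
    rw [le_div_iff₀ hs, ← pow_succ]
    exact pow_le_pow_right₀ h1 hpq
  have e2 : sq n ^ p / sq n ≤ sq n ^ p := div_le_self (by positivity) h1
  have e : u n - 0 * sq n ^ q = (u n - c * sq n ^ p) + c * sq n ^ p := by ring
  rw [e]
  refine (abs_add_le _ _).trans ?_
  rw [abs_mul, abs_of_pos (by positivity : 0 < sq n ^ p)]
  have e3 : K * (sq n ^ p / sq n) ≤ |K| * (sq n ^ q / sq n) := by
    calc _ ≤ |K| * (sq n ^ p / sq n) := by
          gcongr; exact le_abs_self K
      _ ≤ _ := by gcongr ?_ * ?_; exact e2.trans e1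
  have e4 : |c| * sq n ^ p ≤ |c| * (sq n ^ q / sq n) := by gcongr
  linarith [hK n]

/-- Summation. -/
lemma Asy.summ {p : ℕ} {u v : ℕ → ℝ} {c : ℝ} (h : Asy p v c) (hu : ∀ n, u (n + 1) = u n + v n) :
    Asy (p + 2) u (2 * c / (p + 2)) := by
  obtain ⟨K, hK⟩ := h
  obtain ⟨L, hL0, hL⟩ := pow_diff (p + 2)
  set d := 2 * c / (p + 2) with hd
  set M := max |u 0 - d * sq 0 ^ (p + 2)| (3 * (K + |d| * L)) with hM
  have hM0 : 0 ≤ M := (abs_nonneg _).trans (le_max_left _ _)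
  have main : ∀ n, |u n - d * sq n ^ (p + 2)| ≤ M * sq n ^ (p + 1) := by
    intro n
    induction n with
    | zero =>
      calc _ ≤ M := le_max_left _ _
        _ ≤ _ := le_mul_of_one_le_right hM0 (one_le_pow₀ (one_le_sq 0))
    | succ n ih =>
      have hs := one_le_sq n
      have hs0 := sq_pos n
      have ht := sq_pos (n + 1)
      have hst := sq_succ n
      have A := hL _ _ hs ht.le hst
      have B := hK n
      obtain ⟨C1, C2⟩ := step_le hs ht.le hst
      have C3 := step_ge hs ht.le hst
      set s := sq n
      set t := sq (n + 1)
      have e1 : ((p + 2 : ℕ) / 2 : ℝ) * (s ^ (p + 2) / s ^ 2) = (p + 2) / 2 * s ^ p := by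
        rw [pow_add]; push_cast; field_simp
      have e2 : s ^ (p + 2) / s ^ 3 = s ^ p / s := by
        rw [pow_add]; field_simp
      rw [e1, e2] at A
      have hdc : d * ((p + 2) / 2) = c := by
        rw [hd]; field_simp
      have e3 : u (n + 1) - d * t ^ (p + 2) = (u n - d * s ^ (p + 2)) + (v n - c * s ^ p)
          - d * (t ^ (p + 2) - s ^ (p + 2) - (p + 2) / 2 * s ^ p) := by
        rw [hu, ← hdc]; ring
      have A' : |d * (t ^ (p + 2) - s ^ (p + 2) - (p + 2) / 2 * s ^ p)| ≤ |d| * L * (s ^ p / s) := by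
        rw [abs_mul, mul_assoc]; gcongr
      have D : s ^ p / s ≤ 3 * (t ^ (p + 1) - s ^ (p + 1)) := by
        have : s ^ p * (t - s) ≤ t ^ (p + 1) - s ^ (p + 1) := by
          have : s ^ p * t ≤ t ^ p * t := by gcongr
          rw [pow_succ, pow_succ]; linarith
        have h2 : s ^ p * (1 / (3 * s)) ≤ s ^ p * (t - s) := by gcongr
        have h3 : s ^ p * (1 / (3 * s)) = (s ^ p / s) / 3 := by field_simp
        linarith
      have D0 : 0 ≤ s ^ p / s := by positivity
      have E1 : (K + |d| * L) * (s ^ p / s) ≤ M / 3 * (s ^ p / s) := by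
        gcongr
        have := le_max_right |u 0 - d * sq 0 ^ (p + 2)| (3 * (K + |d| * L))
        linarith
      have E2 : M / 3 * (s ^ p / s) ≤ M / 3 * (3 * (t ^ (p + 1) - s ^ (p + 1))) := by gcongr
      rw [e3]
      refine (abs_sub _ _).trans ?_
      have := abs_add_le (u n - d * s ^ (p + 2)) (v n - c * s ^ p)
      linarith
  refine ⟨M, fun n => ?_⟩
  have : sq n ^ (p + 2) / sq n = sq n ^ (p + 1) := by
    have := sq_pos n
    rw [pow_succ]; field_simp
  rw [this]; exact main n

/-- Contraction. -/
lemma Asy.contr {p : ℕ} {u v : ℕ → ℝ} {c : ℝ} (h : Asy (p + 1) v c)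
    (hu : ∀ n, u (n + 1) = u n / 2 + v n / 2) : Asy (p + 1) u c := by
  obtain ⟨K, hK⟩ := h
  obtain ⟨L, hL0, hL⟩ := pow_diff' (p + 1)
  set M := max |u 0 - c * sq 0 ^ (p + 1)| (K + 2 * |c| * L) with hM
  have hM0 : 0 ≤ M := (abs_nonneg _).trans (le_max_left _ _)
  have hdiv : ∀ n, sq n ^ (p + 1) / sq n = sq n ^ p := fun n => by
    have := sq_pos n
    rw [pow_succ]; field_simp
  refine ⟨M, fun n => ?_⟩
  rw [hdiv]
  induction n with
  | zero =>
    calc _ ≤ M := le_max_left _ _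
      _ ≤ _ := le_mul_of_one_le_right hM0 (one_le_pow₀ (one_le_sq 0))
  | succ n ih =>
    have hs := one_le_sq n
    have hs0 := sq_pos n
    have ht := sq_pos (n + 1)
    have hst := sq_succ n
    have A := hL _ _ hs ht.le hst
    have B := hK n
    rw [hdiv] at A B
    obtain ⟨C1, C2⟩ := step_le hs ht.le hst
    set s := sq n
    set t := sq (n + 1)
    have e3 : u (n + 1) - c * t ^ (p + 1) = (u n - c * s ^ (p + 1)) / 2
        + (v n - c * s ^ (p + 1)) / 2 - c * (t ^ (p + 1) - s ^ (p + 1)) := by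
      rw [hu]; ring
    have A' : |c * (t ^ (p + 1) - s ^ (p + 1))| ≤ |c| * L * s ^ p := by
      rw [abs_mul, mul_assoc]; gcongr
    have E1 : (K + 2 * |c| * L) * s ^ p ≤ M * s ^ p := by
      gcongr; exact le_max_right _ _
    have E2 : M * s ^ p ≤ M * t ^ p := by gcongr
    rw [e3]
    refine (abs_sub _ _).trans ?_
    have h1 := abs_add_le ((u n - c * s ^ (p + 1)) / 2) ((v n - c * s ^ (p + 1)) / 2)
    rw [abs_div, abs_div, abs_of_pos (by norm_num : (0 : ℝ) < 2)] at h1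
    linarith

/-! ### The Bessel operator -/

noncomputable def D (f : ℕ → ℝ) (y : ℕ) : ℝ := if y = 0 then 0 else f (y + 1) + f (y - 1)

noncomputable def Th (n : ℕ) (f : ℕ → ℝ) : ℝ := (D^[n] f) 1

noncomputable def fq (q : ℕ) (y : ℕ) : ℝ := if y = 0 then 0 else (y : ℝ) ^ q

lemma D_add (f h : ℕ → ℝ) : D (f + h) = D f + D h := by
  ext y; simp only [D, Pi.add_apply]; split_ifs <;> ring

lemma D_smul (a : ℝ) (f : ℕ → ℝ) : D (a • f) = a • D f := by
  ext y; simp only [D, Pi.smul_apply, smul_eq_mul]; split_ifs <;> ring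

lemma Dit_add (n : ℕ) (f h : ℕ → ℝ) : D^[n] (f + h) = D^[n] f + D^[n] h := by
  induction n generalizing f h with
  | zero => rfl
  | succ n ih => simp only [Function.iterate_succ_apply, D_add, ih]

lemma Dit_smul (n : ℕ) (a : ℝ) (f : ℕ → ℝ) : D^[n] (a • f) = a • D^[n] f := by
  induction n generalizing f with
  | zero => rfl
  | succ n ih => simp only [Function.iterate_succ_apply, D_smul, ih]

lemma Th_add (n : ℕ) (f h : ℕ → ℝ) : Th n (f + h) = Th n f + Th n h := by
  simp [Th, Dit_add]

lemma Th_smul (n : ℕ) (a : ℝ) (f : ℕ → ℝ) : Th n (a • f) = a * Th n f := by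
  simp [Th, Dit_smul]

lemma Th_succ (n : ℕ) (f : ℕ → ℝ) : Th (n + 1) f = Th n (D f) := rfl

lemma Th_sum (n : ℕ) {ι : Type*} (I : Finset ι) (f : ι → ℕ → ℝ) :
    Th n (∑ i ∈ I, f i) = ∑ i ∈ I, Th n (f i) := by
  classical
  induction I using Finset.induction_on with
  | empty =>
    have := Th_smul n 0 0
    simpa using this
  | insert a s ha ih => rw [Finset.sum_insert ha, Finset.sum_insert ha, Th_add, ih]

lemma D_fq (q : ℕ) : D (fq (q + 1)) =
    ∑ m ∈ Finset.range (q + 2), ((1 + (-1) ^ m) * ((q + 1).choose m : ℝ)) • fq (q + 1 - m) := by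
  ext y
  rw [Finset.sum_apply]
  simp only [Pi.smul_apply, smul_eq_mul]
  rcases y with _ | y
  · simp [D, fq]
  · have h1 : D (fq (q + 1)) (y + 1) = ((y + 1 : ℝ) + 1) ^ (q + 1) + ((y + 1 : ℝ) + -1) ^ (q + 1) := by
      simp only [D, fq]
      rcases y with _ | y
      · simp; norm_num
      · simp
    rw [h1, add_comm (y + 1 : ℝ) 1, add_comm (y + 1 : ℝ) (-1), add_pow, add_pow,
      ← Finset.sum_add_distrib]
    refine Finset.sum_congr rfl fun m _ => ?_
    simp [fq]
    ring

/-- explicit formula for the number of positive paths -/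
lemma H_diff (n y : ℕ) :
    (D^[n] (fq 0)) (y + 1) - (D^[n] (fq 0)) y = (n.choose ((n + y + 1) / 2) : ℝ) ∧
      (D^[n] (fq 0)) 0 = 0 := by
  induction n generalizing y with
  | zero =>
    refine ⟨?_, by simp [fq]⟩
    rcases y with _ | y
    · simp [fq]
    · simp only [Function.iterate_zero, id, fq]
      rw [Nat.choose_eq_zero_of_lt (by omega)]
      simp
  | succ n ih =>
    have h0 : (D^[n + 1] (fq 0)) 0 = 0 := by
      rw [Function.iterate_succ_apply']; simp [D]
    refine ⟨?_, h0⟩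
    rcases y with _ | y
    · rw [h0, Function.iterate_succ_apply']
      have a := (ih 0).1
      have b := (ih 1).1
      have z := (ih 0).2
      simp only [D, zero_add] at *
      have e : n.choose ((n + 0 + 1) / 2) = n.choose (n / 2) := by
        rw [← Nat.choose_symm (by omega : n / 2 ≤ n)]
        congr 1; omega
      have e1 : (n + 1 + 0 + 1) / 2 = n / 2 + 1 := by omega
      have e2 : (n + 1 + 1) / 2 = n / 2 + 1 := by omega
      rw [e1, Nat.choose_succ_succ, Nat.cast_add, ← e]
      rw [e2] at b
      simp
      simp at a b z
      linarith
    · rw [Function.iterate_succ_apply']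
      have a := (ih (y + 2)).1
      have b := (ih y).1
      simp only [D] at *
      have e1 : (n + 1 + (y + 1) + 1) / 2 = (n + y + 1) / 2 + 1 := by omega
      have e2 : (n + (y + 2) + 1) / 2 = (n + y + 1) / 2 + 1 := by omega
      rw [e1, Nat.choose_succ_succ, Nat.cast_add]
      rw [e2] at a
      simp
      linarith

noncomputable def B (q n : ℕ) : ℝ := Th n (fq q) / 2 ^ n

lemma B_zero (n : ℕ) : B 0 n = (n.choose ((n + 1) / 2) : ℝ) / 2 ^ n := by
  have := H_diff n 0
  rw [this.2] at this
  unfold B Th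
  rw [← this.1]; simp

lemma B_succ (q n : ℕ) : B (q + 1) (n + 1) = ∑ m ∈ Finset.range (q + 2),
    ((1 + (-1) ^ m) / 2 * ((q + 1).choose m : ℝ)) * B (q + 1 - m) n := by
  unfold B
  rw [Th_succ, D_fq, Th_sum, Finset.sum_div]
  refine Finset.sum_congr rfl fun m _ => ?_
  rw [Th_smul, pow_succ]
  field_simp

lemma B_one (n : ℕ) : B 1 n = 1 := by
  induction n with
  | zero => simp [B, Th, fq]
  | succ n ih => rw [B_succ]; simp [Finset.sum_range_succ, ih]

lemma B_zero_bdd (n : ℕ) : |B 0 n| ≤ 1 := by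
  rw [B_zero, abs_of_nonneg (by positivity), div_le_one (by positivity)]
  exact_mod_cast Nat.choose_le_two_pow n _

noncomputable def wk (k : ℕ) : ℝ := (Nat.centralBinom k : ℝ) / 4 ^ k

lemma wk_succ (k : ℕ) : (2 * k + 2) * wk (k + 1) = (2 * k + 1) * wk k := by
  have h : ((k + 1 : ℕ) : ℝ) * (Nat.centralBinom (k + 1) : ℝ)
      = (2 * (2 * k + 1) : ℕ) * (Nat.centralBinom k : ℝ) := by
    exact_mod_cast Nat.succ_mul_centralBinom_succ k
  push_cast at h
  unfold wk
  rw [pow_succ]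
  field_simp
  linarith

lemma B_zero_even (k : ℕ) : B 0 (2 * k) = wk k := by
  rw [B_zero, wk, Nat.centralBinom_eq_two_mul_choose, pow_mul]
  have : (2 * k + 1) / 2 = k := by omega
  rw [this]; norm_num

lemma B_zero_odd (k : ℕ) : B 0 (2 * k + 1) = wk (k + 1) := by
  rw [B_zero, wk, Nat.centralBinom_eq_two_mul_choose]
  have : (2 * k + 1 + 1) / 2 = k + 1 := by omega
  rw [this]
  have e : (2 * (k + 1)).choose (k + 1) = 2 * (2 * k + 1).choose (k + 1) := by
    have : 2 * (k + 1) = 2 * k + 1 + 1 := by ring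
    rw [this, Nat.choose_succ_succ, Nat.choose_symm_half]; ring
  rw [e, pow_succ, pow_mul, pow_succ]
  push_cast
  norm_num
  field_simp
  ring

lemma B_two_succ (n : ℕ) : B 2 (n + 1) = B 2 n + B 0 n := by
  rw [B_succ]; norm_num [Finset.sum_range_succ]

lemma B_two_even (k : ℕ) : B 2 (2 * k) = (4 * k + 1) * wk k := by
  induction k with
  | zero => simp [B, Th, fq, wk]
  | succ k ih =>
    have : 2 * (k + 1) = 2 * k + 1 + 1 := by ring
    rw [this, B_two_succ, B_two_succ, ih, B_zero_even, B_zero_odd]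
    have := wk_succ k
    push_cast
    linarith

lemma wk_wallis (k : ℕ) : wk k ^ 2 * (2 * k + 1) * Real.Wallis.W k = 1 := by
  induction k with
  | zero => simp [wk, Real.Wallis.W]
  | succ k ih =>
    rw [Real.Wallis.W_succ]
    have h := wk_succ k
    have h2 : wk (k + 1) = (2 * k + 1) / (2 * k + 2) * wk k := by
      field_simp; linarith
    rw [h2]
    push_cast
    field_simp
    linear_combination (2 * (k : ℝ) + 3) * ih

lemma wk_nonneg (k : ℕ) : 0 ≤ wk k := by unfold wk; positivity

lemma wk_le_one (k : ℕ) : wk k ≤ 1 := by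
  rw [← B_zero_even]; exact (le_abs_self _).trans (B_zero_bdd _)

lemma B_two_even_bd (k : ℕ) :
    |B 2 (2 * k) - 2 * √(2 / Real.pi) * sq (2 * k)| ≤ 3 := by
  have hpi := Real.pi_gt_three
  have h := wk_wallis k
  have l1 := Real.Wallis.le_W k
  have l2 := Real.Wallis.W_le k
  have hW := Real.Wallis.W_pos k
  have w0 := wk_nonneg k
  have w1 := wk_le_one k
  have hs := sq_sq (2 * k)
  have s1 := one_le_sq (2 * k)
  push_cast at hs
  set s := sq (2 * k)
  set c := √(2 / Real.pi)
  have c0 : 0 ≤ c := Real.sqrt_nonneg _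
  have hc : c ^ 2 = 2 / Real.pi := Real.sq_sqrt (by positivity)
  have hc' : c ^ 2 * Real.pi = 2 := by rw [hc]; field_simp
  have c1 : c ≤ 1 := by nlinarith
  rw [B_two_even]
  have e : (4 * k + 1) * wk k = 2 * s * (wk k * s) - wk k := by
    have : 2 * s * (wk k * s) = 2 * s ^ 2 * wk k := by ring
    rw [this, hs]; ring
  set x := wk k * s with hx
  have x0 : 0 ≤ x := by positivity
  have hx2 : x ^ 2 * Real.Wallis.W k = 1 := by rw [hx, mul_pow, hs]; exact h
  have lo : c ≤ x := by
    have : c ^ 2 ≤ x ^ 2 := by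
      by_contra hh
      push Not at hh
      nlinarith
    exact le_of_sq_le_sq this x0
  have k0 : (0 : ℝ) ≤ k := by positivity
  have hi : x ^ 2 * s ^ 2 ≤ c ^ 2 * (s ^ 2 + 1) := by
    have l1' : s ^ 2 * (Real.pi / 2) ≤ (s ^ 2 + 1) * Real.Wallis.W k := by
      rw [hs]
      have e : (2 * (k : ℝ) + 1) * (Real.pi / 2)
        = ((2 * k + 1) / (2 * k + 2) * (Real.pi / 2)) * (2 * k + 1 + 1) := by field_simp; ring
      rw [e, mul_comm _ (Real.Wallis.W k)]
      gcongr
    have : x ^ 2 * (s ^ 2 * (Real.pi / 2)) ≤ x ^ 2 * ((s ^ 2 + 1) * Real.Wallis.W k) := by gcongr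
    have e5 : x ^ 2 * ((s ^ 2 + 1) * Real.Wallis.W k) = s ^ 2 + 1 := by
      linear_combination (s ^ 2 + 1) * hx2
    rw [e5] at this
    have := mul_le_mul_of_nonneg_left this (sq_nonneg c)
    have e6 : c ^ 2 * (x ^ 2 * (s ^ 2 * (Real.pi / 2))) = x ^ 2 * s ^ 2 := by
      linear_combination (x ^ 2 * s ^ 2 / 2) * hc'
    linarith
  have hi2 : s * (x - c) ≤ 1 := by
    have a1 : (x * s) ^ 2 ≤ (c * s + 1) ^ 2 := by nlinarith [mul_nonneg c0 (by linarith : 0 ≤ s)]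
    have := le_of_sq_le_sq a1 (by positivity)
    nlinarith
  have lo2 : 0 ≤ s * (x - c) := mul_nonneg (by linarith) (by linarith)
  rw [e, abs_le]
  constructor <;> nlinarith

lemma B_two_asy : Asy 1 (B 2) (2 * √(2 / Real.pi)) := by
  refine ⟨10, fun n => ?_⟩
  have : sq n ^ 1 / sq n = 1 := by rw [pow_one]; exact div_self (sq_pos n).ne'
  rw [this, pow_one, mul_one]
  rcases Nat.even_or_odd' n with ⟨k, rfl | rfl⟩
  · exact (B_two_even_bd k).trans (by norm_num)
  · have a := B_two_even_bd k
    rw [B_two_succ]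
    have b := B_zero_bdd (2 * k)
    have hs := one_le_sq (2 * k)
    have ht := sq_pos (2 * k + 1)
    have h := sq_succ (2 * k)
    obtain ⟨h1, -⟩ := step_le hs ht.le h
    have h3 : sq (2 * k + 1) - sq (2 * k) ≤ 1 := by nlinarith
    have c1 : √(2 / Real.pi) ≤ 1 := by
      rw [Real.sqrt_le_one, div_le_one Real.pi_pos]; linarith [Real.pi_gt_three]
    have c0 : 0 ≤ √(2 / Real.pi) := Real.sqrt_nonneg _
    rw [abs_le] at *
    constructor <;> nlinarith

noncomputable def kap (r : ℕ) : ℝ :=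
  ((r + 1).factorial : ℝ) * (8 : ℝ) ^ (-(r : ℝ) / 2) / Real.Gamma ((r : ℝ) / 2 + 1)

lemma kap_zero : kap 0 = 1 := by simp [kap]

lemma kap_one : 2 * kap 1 = 2 * √(2 / Real.pi) := by
  have h1 : Real.Gamma (((1 : ℕ) : ℝ) / 2 + 1) = √Real.pi / 2 := by
    rw [Real.Gamma_add_one (by norm_num)]
    push_cast
    rw [Real.Gamma_one_half_eq]; ring
  have h2 : (8 : ℝ) ^ (-((1 : ℕ) : ℝ) / 2) = (2 * √2)⁻¹ := by
    rw [show (-((1 : ℕ) : ℝ) / 2) = -(1 / 2) by norm_num, Real.rpow_neg (by norm_num),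
      ← Real.sqrt_eq_rpow, show (8 : ℝ) = 2 ^ 2 * 2 by norm_num,
      Real.sqrt_mul (by norm_num), Real.sqrt_sq (by norm_num)]
  unfold kap
  rw [h1, h2, Real.sqrt_div (by norm_num)]
  have : √2 * √2 = (2 : ℝ) := Real.mul_self_sqrt (by norm_num)
  have h3 : (0 : ℝ) < √2 := by positivity
  have h4 : (0 : ℝ) < √Real.pi := Real.sqrt_pos.2 Real.pi_pos
  norm_num [Nat.factorial]
  field_simp
  nlinarith

lemma kap_step (r : ℕ) : 4 * kap (r + 2) = (r + 3) * kap r := by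
  unfold kap
  have h1 : Real.Gamma (((r + 2 : ℕ) : ℝ) / 2 + 1) = (r / 2 + 1) * Real.Gamma ((r : ℝ) / 2 + 1) := by
    rw [← Real.Gamma_add_one (by positivity)]
    congr 1; push_cast; ring
  have h2 : (8 : ℝ) ^ (-((r + 2 : ℕ) : ℝ) / 2) = (8 : ℝ) ^ (-(r : ℝ) / 2) / 8 := by
    rw [show (-((r + 2 : ℕ) : ℝ) / 2) = -(r : ℝ) / 2 - 1 by push_cast; ring,
      Real.rpow_sub (by norm_num), Real.rpow_one]
  have h3 : ((r + 2 + 1).factorial : ℝ) = (r + 3) * (r + 2) * ((r + 1).factorial : ℝ) := by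
    rw [Nat.factorial_succ, Nat.factorial_succ (r + 1)]; push_cast; ring
  rw [h1, h2, h3]
  have : 0 < Real.Gamma ((r : ℝ) / 2 + 1) := Real.Gamma_pos_of_pos (by positivity)
  field_simp
  ring

lemma B_asy (p : ℕ) : Asy p (B (p + 1)) (2 ^ p * kap p) := by
  induction p using Nat.strong_induction_on with
  | _ p ih =>
    rcases p with _ | _ | p
    · refine ⟨0, fun n => ?_⟩
      simp [B_one, kap_zero]
    · have := B_two_asy
      rw [← kap_one] at this
      simpa using this
    · have key : Asy p (fun n => (((p + 3).choose 2 : ℝ)) * B (p + 1) n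
          + ∑ m ∈ Finset.range p, ((1 + (-1) ^ (m + 4)) / 2 * ((p + 3).choose (m + 4) : ℝ)) * B (p + 3 - (m + 4)) n)
          (((p + 3).choose 2 : ℝ) * (2 ^ p * kap p) + ∑ m ∈ Finset.range p, 0) := by
        refine ((ih p (by omega)).const_mul _).add (Asy.sum _ _ _ ?_)
        intro m hm
        rw [Finset.mem_range] at hm
        rcases Nat.lt_or_ge (m + 1) p with h | h
        · have := (ih (p - 1 - (m + 1)) (by omega)).lower (q := p) (by omega)
          rw [show p - 1 - (m + 1) + 1 = p + 3 - (m + 4) by omega] at this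
          simpa using this.const_mul ((1 + (-1) ^ (m + 4)) / 2 * ((p + 3).choose (m + 4) : ℝ))
        · have e : p + 3 - (m + 4) = 0 := by omega
          rw [e]
          have := Asy.of_bdd (p := p) (by omega) B_zero_bdd
          simpa using this.const_mul ((1 + (-1) ^ (m + 4)) / 2 * ((p + 3).choose (m + 4) : ℝ))
      have := key.summ (u := B (p + 2 + 1)) ?_
      · refine this.congr (fun _ => rfl) ?_
        have hk := kap_step p
        have hch : ((p + 3).choose 2 : ℝ) = (p + 3) * (p + 2) / 2 := by
          rw [Nat.cast_choose_two]; push_cast; ring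
        rw [hch, pow_add]
        simp only [Finset.sum_const_zero, add_zero]
        field_simp
        linear_combination (-(2 : ℝ) ^ p) * hk
      · intro n
        rw [B_succ, Finset.sum_range_succ', Finset.sum_range_succ', Finset.sum_range_succ', Finset.sum_range_succ']
        simp
        ring

/-! ### Expectations over words -/

noncomputable def Ev (n : ℕ) (F : List Bool → ℝ) : ℝ :=
  (∑ w : Fin n → Bool, F (List.ofFn w)) / 2 ^ n

lemma Ev_zero (F : List Bool → ℝ) : Ev 0 F = F [] := by simp [Ev]

lemma Ev_succ (n : ℕ) (F : List Bool → ℝ) :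
    Ev (n + 1) F = Ev n (fun w => F (true :: w)) / 2 + Ev n (fun w => F (false :: w)) / 2 := by
  unfold Ev
  rw [← (Fin.consEquiv (fun _ : Fin (n + 1) => Bool)).sum_comp, Fintype.sum_prod_type]
  simp only [Fintype.sum_bool, Fin.consEquiv, Equiv.coe_fn_mk, List.ofFn_cons, pow_succ]
  field_simp

lemma Ev_add (n : ℕ) (F G : List Bool → ℝ) : Ev n (fun w => F w + G w) = Ev n F + Ev n G := by
  unfold Ev; rw [Finset.sum_add_distrib, add_div]

lemma Ev_mul (n : ℕ) (a : ℝ) (F : List Bool → ℝ) : Ev n (fun w => a * F w) = a * Ev n F := by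
  unfold Ev; rw [← Finset.mul_sum, mul_div_assoc]

lemma Ev_sum (n : ℕ) {ι : Type*} (I : Finset ι) (F : ι → List Bool → ℝ) :
    Ev n (fun w => ∑ i ∈ I, F i w) = ∑ i ∈ I, Ev n (F i) := by
  unfold Ev; rw [Finset.sum_comm, Finset.sum_div]

lemma Ev_congr (n : ℕ) {F G : List Bool → ℝ} (h : ∀ w, F w = G w) : Ev n F = Ev n G := by
  rw [funext h]

lemma Ev_one (n : ℕ) : Ev n (fun _ => 1) = 1 := by
  simp [Ev]

lemma Ev_poly {p : ℕ} (F : List Bool → ℝ) (c : ℕ → ℝ) (P : Polynomial ℝ) (hP : P.natDegree ≤ p)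
    (h : ∀ q ≤ p, P.coeff q ≠ 0 → Asy q (fun n => Ev n (fun w => F w ^ q)) (c q)) :
    Asy p (fun n => Ev n (fun w => P.eval (F w))) (P.coeff p * c p) := by
  have e : ∀ n, ∑ q ∈ Finset.range (p + 1), P.coeff q * Ev n (fun w => F w ^ q)
      = Ev n (fun w => P.eval (F w)) := by
    intro n
    rw [Ev_congr n (fun w => Polynomial.eval_eq_sum_range' (Nat.lt_succ_of_le hP) (F w)), Ev_sum]
    exact Finset.sum_congr rfl fun q _ => (Ev_mul _ _ _).symm
  refine (Asy.sum (Finset.range (p + 1)) _ (fun q => if q = p then P.coeff p * c p else 0) ?_).congr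
    e (by simp)
  intro q hq
  rw [Finset.mem_range] at hq
  by_cases h0 : P.coeff q = 0
  · rcases eq_or_ne q p with rfl | hne
    · simpa [h0] using Asy.zero q
    · simpa [h0, hne] using Asy.zero p
  · have := h q (by omega) h0
    rcases eq_or_ne q p with rfl | hne
    · simpa using this.const_mul (P.coeff q)
    · simpa [hne] using (this.lower (by omega : q < p)).const_mul (P.coeff q)

/-! ### The walk of a word -/

def dd : List Bool → ℤ
  | [] => 0
  | x :: w => dd w + if x then 1 else -1

def nn : List Bool → ℕ
  | [] => 0
  | x :: w => nn w + if x = true ∧ dd w = -1 then 1 else 0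

lemma dd_count (w : List Bool) : dd w = w.count true - w.count false := by
  induction w with
  | nil => simp [dd]
  | cons x w ih => cases x <;> simp [dd, ih] <;> ring

lemma chat_eq (w : List Bool) : (2 * chat w : ℤ) = w.length + |dd w| + 2 * nn w := by
  induction w with
  | nil => simp [chat, dd, nn]
  | cons x w ih =>
    have h := dd_count w
    simp only [chat, dd, nn, List.length_cons]
    push_cast
    cases x
    · simp
      rcases abs_cases (dd w) with h1 | h1 <;> rcases abs_cases (dd w + -1) with h2 | h2 <;>
        split_ifs <;> omega
    · simp
      rcases abs_cases (dd w) with h1 | h1 <;> rcases abs_cases (dd w + 1) with h2 | h2 <;>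
        split_ifs <;> omega

/-- sum over the fibre -/
noncomputable def Lam (F : ℤ → ℕ → ℝ) (y : ℕ) : ℝ :=
  ∑ i ∈ Finset.range y, F ((y : ℤ) - 1 - 2 * i) (min i (y - 1 - i))

noncomputable def UU (F : ℤ → ℕ → ℝ) (d : ℤ) (N : ℕ) : ℝ :=
  F (d + 1) (N + if d = -1 then 1 else 0) + F (d - 1) N

lemma Lam_UU (F : ℤ → ℕ → ℝ) : Lam (UU F) = D (Lam F) := by
  ext y
  rcases y with _ | y
  · simp [Lam, D]
  · simp only [D, Lam, UU, Finset.sum_add_distrib, Nat.succ_ne_zero, if_false]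
    rw [Finset.sum_range_succ', Finset.sum_range_succ (n := y), Finset.sum_range_succ' (n := y + 1),
      Finset.sum_range_succ (n := y), Nat.add_sub_cancel]
    have key : ∀ i ∈ Finset.range y,
        F (((y + 1 : ℕ) : ℤ) - 1 - 2 * ((i + 1 : ℕ) : ℤ) + 1)
            (min (i + 1) (y + 1 - 1 - (i + 1)) +
              if ((y + 1 : ℕ) : ℤ) - 1 - 2 * ((i + 1 : ℕ) : ℤ) = -1 then 1 else 0)
          + F (((y + 1 : ℕ) : ℤ) - 1 - 2 * (i : ℤ) - 1) (min i (y + 1 - 1 - i))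
        = F (((y + 1 + 1 : ℕ) : ℤ) - 1 - 2 * ((i + 1 : ℕ) : ℤ)) (min (i + 1) (y + 1 + 1 - 1 - (i + 1)))
          + F ((y : ℤ) - 1 - 2 * i) (min i (y - 1 - i)) := by
      intro i hi
      rw [Finset.mem_range] at hi
      have e1 : ((y + 1 : ℕ) : ℤ) - 1 - 2 * ((i + 1 : ℕ) : ℤ) + 1 = (y : ℤ) - 1 - 2 * i := by
        push_cast; ring
      have e2 : ((y + 1 : ℕ) : ℤ) - 1 - 2 * (i : ℤ) - 1 = (y : ℤ) - 1 - 2 * i := by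
        push_cast; ring
      have e3 : ((y + 1 + 1 : ℕ) : ℤ) - 1 - 2 * ((i + 1 : ℕ) : ℤ) = (y : ℤ) - 1 - 2 * i := by
        push_cast; ring
      rw [e1, e2, e3]
      by_cases hc : 2 * (i + 1) ≤ y + 1
      · congr 2
        · push_cast; split_ifs <;> omega
        · omega
      · rw [add_comm]
        congr 2
        · omega
        · push_cast; split_ifs <;> omega
    have k2 := Finset.sum_congr rfl key
    rw [Finset.sum_add_distrib, Finset.sum_add_distrib] at k2
    have b0 : F (((y + 1 : ℕ) : ℤ) - 1 - 2 * ((0 : ℕ) : ℤ) + 1)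
            (min 0 (y + 1 - 1 - 0) +
              if ((y + 1 : ℕ) : ℤ) - 1 - 2 * ((0 : ℕ) : ℤ) = -1 then 1 else 0)
        = F (((y + 1 + 1 : ℕ) : ℤ) - 1 - 2 * ((0 : ℕ) : ℤ)) (min 0 (y + 1 + 1 - 1 - 0)) := by
      congr 1
      · push_cast; ring
      · push_cast; split_ifs <;> omega
    have b1 : F (((y + 1 : ℕ) : ℤ) - 1 - 2 * (y : ℤ) - 1) (min y (y + 1 - 1 - y))
        = F (((y + 1 + 1 : ℕ) : ℤ) - 1 - 2 * ((y + 1 : ℕ) : ℤ)) (min (y + 1) (y + 1 + 1 - 1 - (y + 1))) := by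
      congr 1
      · push_cast; ring
      · omega
    simp only [Nat.add_sub_cancel] at k2 b0 b1 ⊢
    linarith

lemma Ev_state (n : ℕ) (F : ℤ → ℕ → ℝ) :
    Ev n (fun w => F (dd w) (nn w)) = Th n (Lam F) / 2 ^ n := by
  induction n generalizing F with
  | zero => rw [Ev_zero]; simp [dd, nn, Th, Lam]
  | succ n ih =>
    rw [Ev_succ, Th_succ, ← Lam_UU, ← add_div, ← Ev_add, pow_succ, ← div_div, ← ih]
    congr 2
    ext w
    simp [dd, nn, UU, sub_eq_add_neg]

lemma Ev_Y (p n : ℕ) :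
    Ev n (fun w => (2 * ((chat w : ℝ) - (w.length : ℝ) / 2) + 1) ^ p) = B (p + 1) n := by
  unfold B
  have h : Lam (fun d N => (((|d| + 2 * N + 1 : ℤ)) : ℝ) ^ p) = fq (p + 1) := by
    ext y
    unfold Lam fq
    rw [Finset.sum_congr rfl (g := fun _ => (y : ℝ) ^ p)]
    · rw [Finset.sum_const, Finset.card_range, nsmul_eq_mul]
      split_ifs with h0
      · simp [h0]
      · rw [pow_succ]; ring
    · intro i hi
      rw [Finset.mem_range] at hi
      have hm : |(y : ℤ) - 1 - 2 * i| + 2 * ((min i (y - 1 - i) : ℕ) : ℤ) + 1 = (y : ℤ) := by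
        rcases abs_cases ((y : ℤ) - 1 - 2 * i) with h1 | h1 <;> omega
      beta_reduce
      rw [hm, Int.cast_natCast]
  rw [← h, ← Ev_state]
  refine Ev_congr n fun w => ?_
  have := chat_eq w
  have h2 : (2 * (chat w : ℝ)) = w.length + ((|dd w| : ℤ) : ℝ) + 2 * nn w := by exact_mod_cast this
  congr 1
  push_cast at *
  linarith

noncomputable def chh (w : List Bool) : ℝ := (chat w : ℝ) - (w.length : ℝ) / 2

noncomputable def ghat (w : List Bool) : ℝ := (g w : ℝ) - (w.length : ℝ) / 2

open Polynomial in
lemma chh_shift_asy (a : ℝ) (p : ℕ) : Asy p (fun n => Ev n (fun w => (chh w + a) ^ p)) (kap p) := by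
  have key := Ev_poly (p := p) (fun w => 2 * chh w + 1) (fun q => 2 ^ q * kap q)
    ((C (1 / 2) * X + C (a - 1 / 2)) ^ p) ?_ ?_
  · refine key.congr (fun n => Ev_congr n fun w => ?_) ?_
    · simp; ring
    · have h1 : ((C (1 / 2 : ℝ) * X + C (a - 1 / 2)) ^ p).coeff p = (1 / 2) ^ p := by
        have h := coeff_pow_of_natDegree_le (p := (C (1 / 2 : ℝ) * X + C (a - 1 / 2))) (n := 1) (m := p)
          natDegree_linear_le
        rw [mul_one] at h
        rw [h]; simp
      rw [h1, ← mul_assoc, ← mul_pow]; norm_num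
  · refine natDegree_pow_le.trans ?_
    have : (C (1 / 2 : ℝ) * X + C (a - 1 / 2)).natDegree ≤ 1 := natDegree_linear_le
    nlinarith
  · intro q _ _
    exact (B_asy q).congr (fun n => (Ev_Y q n).symm) rfl

lemma chat_rep (n : ℕ) : chat (List.replicate n false) = n := by
  induction n with
  | zero => simp [chat]
  | succ n ih => simp [List.replicate_succ, chat, ih, List.count_replicate]

lemma ghat_true (w : List Bool) : ghat (true :: w) = ghat w + 1 / 2 := by
  simp [ghat, g]; ring

lemma ghat_false (w : List Bool) : ghat (false :: w) = chh w + -(1 / 2) +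
    if w = List.replicate w.length false then 1 else 0 := by
  simp only [ghat, g, chh, List.length_cons]
  split_ifs with h
  · have : chat w = w.length := by
      conv_lhs => rw [h]
      exact chat_rep _
    rw [this]; push_cast; ring
  · push_cast; ring

lemma Ev_ind (n : ℕ) (G : ℕ → ℝ) :
    Ev n (fun w => if w = List.replicate w.length false then G w.length else 0) = G n / 2 ^ n := by
  unfold Ev
  congr 1
  rw [Finset.sum_eq_single (fun _ => false)]
  · simp
  · intro w _ hw
    beta_reduce
    rw [if_neg]
    intro h
    apply hw
    rw [List.length_ofFn, ← List.ofFn_const] at h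
    exact List.ofFn_injective h
  · simp

lemma exp_bdd (p : ℕ) : ∃ K : ℝ, ∀ n : ℕ, ((n : ℝ) + 1) ^ p / 2 ^ n ≤ K := by
  have h := tendsto_pow_const_div_const_pow_of_one_lt p (by norm_num : (1 : ℝ) < 2)
  obtain ⟨K, hK⟩ := h.bddAbove_range
  refine ⟨2 * K, fun n => ?_⟩
  have := hK ⟨n + 1, rfl⟩
  simp only [pow_succ] at this
  push_cast at this
  rw [← div_div] at this
  linarith

lemma false_asy (p : ℕ) (hp : 1 ≤ p) :
    Asy p (fun n => Ev n (fun w => ghat (false :: w) ^ p)) (kap p) := by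
  have e : ∀ n, Ev n (fun w => ghat (false :: w) ^ p) = Ev n (fun w => (chh w + -(1 / 2)) ^ p)
      + (((n : ℝ) / 2 + 1 / 2) ^ p - ((n : ℝ) / 2 - 1 / 2) ^ p) / 2 ^ n := by
    intro n
    rw [← Ev_ind n (fun n => (((n : ℝ) / 2 + 1 / 2) ^ p - ((n : ℝ) / 2 - 1 / 2) ^ p)), ← Ev_add]
    refine Ev_congr n fun w => ?_
    rw [ghat_false]
    split_ifs with h
    · have : chat w = w.length := by
        conv_lhs => rw [h]
        exact chat_rep _
      simp only [chh, this]
      ring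
    · simp
  obtain ⟨K, hK⟩ := exp_bdd p
  have h2 : Asy p (fun n : ℕ => (((n : ℝ) / 2 + 1 / 2) ^ p - ((n : ℝ) / 2 - 1 / 2) ^ p) / 2 ^ n) 0 := by
    refine Asy.of_bdd hp (K := 2 * K) fun n => ?_
    have n0 : (0 : ℝ) ≤ n := by positivity
    rw [abs_div, abs_of_pos (by positivity : (0 : ℝ) < 2 ^ n)]
    have a1 : |((n : ℝ) / 2 + 1 / 2) ^ p| ≤ ((n : ℝ) + 1) ^ p := by
      rw [abs_pow]; gcongr; rw [abs_le]; constructor <;> linarith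
    have a2 : |((n : ℝ) / 2 - 1 / 2) ^ p| ≤ ((n : ℝ) + 1) ^ p := by
      rw [abs_pow]; gcongr; rw [abs_le]; constructor <;> linarith
    have a3 := abs_sub (((n : ℝ) / 2 + 1 / 2) ^ p) (((n : ℝ) / 2 - 1 / 2) ^ p)
    calc _ ≤ (2 * ((n : ℝ) + 1) ^ p) / 2 ^ n := by gcongr; linarith
      _ = 2 * (((n : ℝ) + 1) ^ p / 2 ^ n) := by ring
      _ ≤ _ := by gcongr; exact hK n
  exact ((chh_shift_asy _ p).add h2).congr (fun n => (e n).symm) (add_zero _)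

open Polynomial in
lemma ghat_asy (p : ℕ) : Asy p (fun n => Ev n (fun w => ghat w ^ p)) (kap p) := by
  induction p using Nat.strong_induction_on with
  | _ p ih =>
    rcases p with _ | p
    · refine ⟨0, fun n => ?_⟩
      simp [Ev_one, kap_zero]
    · have mon : ((X + C (1 / 2 : ℝ)) ^ (p + 1)).coeff (p + 1) = 1 := by
        have h := (monic_X_add_C (1 / 2 : ℝ)).pow (p + 1)
        have h3 : ((X + C (1 / 2 : ℝ)) ^ (p + 1)).natDegree = p + 1 := by
          rw [natDegree_pow, natDegree_X_add_C, mul_one]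
        have := h.coeff_natDegree
        rwa [h3] at this
      have c0 : ((X + C (1 / 2 : ℝ)) ^ (p + 1) - X ^ (p + 1)).coeff (p + 1) = 0 := by
        rw [coeff_sub, mon]; simp
      have tail := Ev_poly (p := p + 1) ghat kap ((X + C (1 / 2 : ℝ)) ^ (p + 1) - X ^ (p + 1)) ?_ ?_
      · rw [c0, zero_mul] at tail
        have hv := (false_asy (p + 1) (by omega)).add tail
        rw [add_zero] at hv
        refine hv.contr fun n => ?_
        rw [Ev_succ]
        have : Ev n (fun w => ghat (true :: w) ^ (p + 1)) = Ev n (fun w => ghat w ^ (p + 1)) +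
            Ev n (fun w => ((X + C (1 / 2 : ℝ)) ^ (p + 1) - X ^ (p + 1)).eval (ghat w)) := by
          rw [← Ev_add]
          refine Ev_congr n fun w => ?_
          rw [ghat_true]; simp
        rw [this]; ring
      · refine (natDegree_sub_le _ _).trans ?_
        rw [natDegree_pow, natDegree_X_add_C, natDegree_X_pow]; simp
      · intro q hq h0
        refine ih q ?_
        rcases Nat.lt_or_ge q (p + 1) with h | h
        · exact h
        · have : q = p + 1 := by omega
          rw [this] at h0
          exact absurd c0 h0

open Polynomial in
lemma fact_asy (r : ℕ) : Asy r (fun n => factMom n r) (kap r) := by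
  have mon : (∏ i ∈ Finset.range r, (X - C (i : ℝ))).Monic :=
    monic_prod_of_monic _ _ fun i _ => monic_X_sub_C _
  have deg : (∏ i ∈ Finset.range r, (X - C (i : ℝ))).natDegree = r := by
    rw [natDegree_prod_of_monic _ _ fun i _ => monic_X_sub_C _]
    simp only [natDegree_X_sub_C]; simp
  have key := Ev_poly (p := r) ghat kap (∏ i ∈ Finset.range r, (X - C (i : ℝ))) deg.le
    fun q _ _ => ghat_asy q
  have c1 := mon.coeff_natDegree
  rw [deg] at c1
  refine key.congr (fun n => ?_) (by rw [c1, one_mul])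
  unfold Ev factMom
  congr 1
  refine Finset.sum_congr rfl fun w _ => ?_
  beta_reduce
  rw [eval_prod]
  simp [ghat]

end Riffle

/-- Asymptotics of the factorial moments: for every fixed `r ≥ 0` there is a
constant `K > 0` with
`|E(X̂_n^{(r)}) - (r+1)!·8^{-r/2}/Γ(r/2+1) · n^{r/2}| ≤ K · n^{(r-1)/2}`
for all `n ≥ 1`. -/
theorem stmt10 (r : ℕ) :
    ∃ K : ℝ, 0 < K ∧ ∀ n : ℕ, 1 ≤ n →
      |factMom n r -
          ((r + 1).factorial : ℝ) * (8 : ℝ) ^ (-(r : ℝ) / 2) / Real.Gamma ((r : ℝ) / 2 + 1) *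
            (n : ℝ) ^ ((r : ℝ) / 2)|
        ≤ K * (n : ℝ) ^ (((r : ℝ) - 1) / 2) := by
  obtain ⟨K, hK⟩ := Riffle.fact_asy r
  obtain ⟨L, hL0, hL⟩ := Riffle.pow_diff' r
  refine ⟨|K| * 2 ^ r + |Riffle.kap r| * L + 1, by positivity, fun n hn => ?_⟩
  have hn1 : (1 : ℝ) ≤ n := by exact_mod_cast hn
  have hs : 1 ≤ √(n : ℝ) := by rw [Real.one_le_sqrt]; exact hn1
  have hst : Riffle.sq n ^ 2 = √(n : ℝ) ^ 2 + 1 := by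
    rw [Riffle.sq_sq, Real.sq_sqrt (by positivity)]
  have ht := Riffle.sq_pos n
  have A := hL _ _ hs ht.le hst
  obtain ⟨C1, C2⟩ := Riffle.step_le hs ht.le hst
  have B := hK n
  have e1 : (n : ℝ) ^ ((r : ℝ) / 2) = √(n : ℝ) ^ r := by
    rw [Real.sqrt_eq_rpow, ← Real.rpow_mul_natCast (by positivity)]
    congr 1; ring
  have e2 : (n : ℝ) ^ (((r : ℝ) - 1) / 2) = √(n : ℝ) ^ r / √(n : ℝ) := by
    rw [← e1, Real.sqrt_eq_rpow, ← Real.rpow_sub (by linarith)]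
    congr 1; ring
  rw [e1, e2]
  change |factMom n r - Riffle.kap r * √(n : ℝ) ^ r| ≤ _
  set s := √(n : ℝ)
  set t := Riffle.sq n
  have s0 : 0 < s := by linarith
  have D : t ^ r / t ≤ 2 ^ r * (s ^ r / s) := by
    rw [← mul_div_assoc, ← mul_pow]
    gcongr
  have e3 : factMom n r - Riffle.kap r * s ^ r
      = (factMom n r - Riffle.kap r * t ^ r) + Riffle.kap r * (t ^ r - s ^ r) := by ring
  rw [e3]
  refine (abs_add_le _ _).trans ?_
  have E1 : K * (t ^ r / t) ≤ |K| * (2 ^ r * (s ^ r / s)) := by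
    calc _ ≤ |K| * (t ^ r / t) := by gcongr; exact le_abs_self K
      _ ≤ _ := by gcongr
  have E2 : |Riffle.kap r * (t ^ r - s ^ r)| ≤ |Riffle.kap r| * (L * (s ^ r / s)) := by
    rw [abs_mul]; gcongr
  have E3 : 0 < s ^ r / s := by positivity
  linarith
end

section
/- Let $(m_1(k))_{k \ge 1}$, $(m_2(k))_{k \ge 1}$ be sequences of nonnegative integers with $m_1(k) \ge m_2(k)$, $m_1(k) \to \infty$, and $(m_1(k) - m_2(k))/\sqrt{m_1(k)} \to \rho$ for some constant $\rho > 0$. Then for every real $z \ge 0$: $\mathbb{P}\big(C_{m_1(k), m_2(k)} \le m_1(k) + z \sqrt{m_1(k)}\big) \to 1 - e^{-z(\rho + z)}$ as $k \to \infty$; i.e., $(C_{m_1,m_2} - m_1)/\sqrt{m_1}$ converges in distribution to the $\mathrm{LinExp}(\rho, 2)$ law. -/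
/-- The words with `m₁` letters `a` and `m₂` letters `b`. -/
def wordsWith (m₁ m₂ : ℕ) : Finset (Fin (m₁ + m₂) → Bool) :=
  Finset.univ.filter fun w => (List.ofFn w).count true = m₁

/-- `P(C_{m₁,m₂} ≤ t)` for the two-color card guessing game. -/
noncomputable def PCle (m₁ m₂ : ℕ) (t : ℝ) : ℝ :=
  (((wordsWith m₁ m₂).filter fun w => (chat (List.ofFn w) : ℝ) ≤ t).card : ℝ) /
    ((m₁ + m₂).choose m₁ : ℝ)


/-- Number of words of length `n` satisfying `Q`. -/
noncomputable def cnt (n : ℕ) (Q : List Bool → Prop) : ℕ :=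
  open Classical in (Finset.univ.filter fun w : Fin n → Bool => Q (List.ofFn w)).card

lemma cnt_succ (n : ℕ) (Q : List Bool → Prop) :
    cnt (n + 1) Q = cnt n (fun w => Q (true :: w)) + cnt n (fun w => Q (false :: w)) := by
  classical
  unfold cnt
  simp only [Finset.card_filter]
  rw [← (Fin.consEquiv (fun _ : Fin (n + 1) => Bool)).sum_comp]
  rw [Fintype.sum_prod_type]
  simp [Fin.consEquiv, List.ofFn_succ]

lemma cnt_congr (n : ℕ) (P Q : List Bool → Prop) (h : ∀ w, w.length = n → (P w ↔ Q w)) :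
    cnt n P = cnt n Q := by
  classical
  unfold cnt
  congr 1
  ext w
  simp [h (List.ofFn w) (by simp)]

lemma cnt_zero_of (n : ℕ) (P : List Bool → Prop) (h : ∀ w, w.length = n → ¬ P w) :
    cnt n P = 0 := by
  classical
  unfold cnt
  rw [Finset.card_eq_zero, Finset.filter_eq_empty_iff]
  intro w _
  exact h _ (by simp)

lemma count_add (w : List Bool) : w.count true + w.count false = w.length := by
  induction w with
  | nil => rfl
  | cons x w ih => cases x <;> simp <;> omega

lemma chat_true (w : List Bool) :
    chat (true :: w) = chat w + if w.count false ≤ w.count true + 1 then 1 else 0 := by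
  simp [chat]

lemma chat_false (w : List Bool) :
    chat (false :: w) = chat w + if w.count true < w.count false + 1 then 1 else 0 := by
  simp [chat]

lemma chat_ge (w : List Bool) : w.count true ≤ chat w ∧ w.count false ≤ chat w := by
  induction w with
  | nil => simp
  | cons x w ih =>
    cases x
    · rw [chat_false]; simp; split_ifs <;> omega
    · rw [chat_true]; simp; split_ifs <;> omega

lemma cnt_main (n : ℕ) : ∀ a t : ℕ, a ≤ n → a ≤ t → n ≤ a + t →
    cnt n (fun w => w.count true = a ∧ t ≤ chat w) = n.choose t := by
  induction n with
  | zero =>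
    intro a t h1 h2 h3
    obtain rfl : a = 0 := by omega
    cases t with
    | zero => simp [cnt]
    | succ t => simp [cnt, chat]
  | succ n ih =>
    intro a t h1 h2 h3
    obtain ⟨t, rfl⟩ : ∃ s, t = s + 1 := ⟨t - 1, by omega⟩
    rw [cnt_succ, Nat.choose_succ_succ]
    rcases lt_trichotomy (n + 1) (2 * a) with h | h | h
    · congr 1
      · rw [← ih (a - 1) t (by omega) (by omega) (by omega)]
        apply cnt_congr
        intro w hw
        have := count_add w
        rw [chat_true]; simp
        split_ifs <;> omega
      · by_cases han : a ≤ n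
        · rw [← ih a (t + 1) (by omega) (by omega) (by omega)]
          apply cnt_congr
          intro w hw
          have := count_add w
          rw [chat_false]; simp
          split_ifs <;> omega
        · rw [Nat.choose_eq_zero_of_lt (by omega)]
          apply cnt_zero_of
          intro w hw
          have := count_add w
          simp; omega
    · congr 1
      · by_cases hat : a = t + 1
        · have hn : n = 2 * t + 1 := by omega
          have e : n.choose t = n.choose (t + 1) := by
            rw [hn]; exact (Nat.choose_symm_half t).symm
          rw [e, ← ih (a - 1) (t + 1) (by omega) (by omega) (by omega)]
          apply cnt_congr
          intro w hw
          have := count_add w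
          have := chat_ge w
          rw [chat_true]; simp
          split_ifs <;> omega
        · rw [← ih (a - 1) t (by omega) (by omega) (by omega)]
          apply cnt_congr
          intro w hw
          have := count_add w
          rw [chat_true]; simp
          split_ifs <;> omega
      · rw [← ih a (t + 1) (by omega) (by omega) (by omega)]
        apply cnt_congr
        intro w hw
        have := count_add w
        rw [chat_false]; simp
        split_ifs <;> omega
    · rw [add_comm (n.choose t)]
      congr 1
      · by_cases ha : a = 0
        · rw [Nat.choose_eq_zero_of_lt (by omega)]
          apply cnt_zero_of
          intro w hw
          simp; omega
        · rw [← ih (a - 1) (t + 1) (by omega) (by omega) (by omega)]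
          apply cnt_congr
          intro w hw
          have := count_add w
          rw [chat_true]; simp
          split_ifs <;> omega
      · rw [← ih a t (by omega) (by omega) (by omega)]
        apply cnt_congr
        intro w hw
        have := count_add w
        rw [chat_false]; simp
        split_ifs <;> omega

lemma PCle_eq (a b : ℕ) (hab : b ≤ a) (x : ℝ) (hx : 0 ≤ x) :
    PCle a b (a + x) = 1 - ((a + b).choose (a + (⌊x⌋₊ + 1)) : ℝ) / ((a + b).choose a : ℝ) := by
  classical
  have hpos : (0 : ℝ) < ((a + b).choose a : ℝ) := by
    exact_mod_cast Nat.choose_pos (by omega)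
  have h1 := cnt_main (a + b) a a (by omega) le_rfl (by omega)
  have h2 := cnt_main (a + b) a (a + (⌊x⌋₊ + 1)) (by omega) (by omega) (by omega)
  have key : ((wordsWith a b).filter fun w => (chat (List.ofFn w) : ℝ) ≤ a + x).card
      + (a + b).choose (a + (⌊x⌋₊ + 1)) = (a + b).choose a := by
    have hT : (wordsWith a b).card = (a + b).choose a := by
      rw [← h1]
      unfold cnt wordsWith
      congr 1
      ext w
      have := (chat_ge (List.ofFn w)).1
      simp only [Finset.mem_filter, Finset.mem_univ, true_and]
      omega
    rw [← hT, ← Finset.card_filter_add_card_filter_not (s := wordsWith a b)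
      (fun w => (chat (List.ofFn w) : ℝ) ≤ a + x), ← h2]
    congr 1
    unfold cnt wordsWith
    rw [Finset.filter_filter]
    congr 1
    ext w
    simp only [Finset.mem_filter, Finset.mem_univ, true_and]
    apply and_congr_right
    intro hw
    have hge := (chat_ge (List.ofFn w)).1
    rw [hw] at hge
    obtain ⟨c, hc⟩ := Nat.exists_eq_add_of_le hge
    rw [hc, not_le]
    push_cast
    rw [add_lt_add_iff_left, ← Nat.floor_lt hx]
    omega
  unfold PCle
  rw [eq_sub_iff_add_eq, ← add_div, div_eq_one_iff_eq hpos.ne']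
  exact_mod_cast key

lemma choose_step (a b j : ℕ) (hj : j ≤ b) :
    ((a + b).choose (a + (j + 1)) : ℝ) = ((a + b).choose (a + j) : ℝ) * ((b - j) / (a + j + 1)) := by
  have h := Nat.choose_succ_right_eq (a + b) (a + j)
  rw [show a + b - (a + j) = b - j by omega] at h
  have h' : ((a + b).choose (a + j + 1) : ℝ) * (a + j + 1) =
      ((a + b).choose (a + j) : ℝ) * (b - j) := by
    have := congrArg (Nat.cast : ℕ → ℝ) h
    push_cast [Nat.cast_sub hj] at this
    exact this
  rw [← add_assoc]
  field_simp
  linarith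

lemma upper (a b J : ℕ) (hab : b ≤ a) (hJ : J < b) : ∀ j ≤ J,
    ((a + b).choose (a + j) : ℝ) ≤
      (a + b).choose a * Real.exp (-((j * ((a : ℝ) - b) + j ^ 2) / (a + J))) := by
  have hab' : (b : ℝ) ≤ a := by exact_mod_cast hab
  have hJ' : (J : ℝ) + 1 ≤ b := by exact_mod_cast hJ
  have hJ0 : (0 : ℝ) ≤ J := by positivity
  intro j
  induction j with
  | zero => intro _; simp
  | succ j ih =>
    intro hj
    have hjr : (j : ℝ) + 1 ≤ J := by exact_mod_cast hj
    have hj0 : (0 : ℝ) ≤ j := by positivity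
    rw [choose_step a b j (by omega)]
    have e : -((((j + 1 : ℕ) : ℝ) * ((a : ℝ) - b) + ((j + 1 : ℕ) : ℝ) ^ 2) / (a + J)) =
        -((j * ((a : ℝ) - b) + j ^ 2) / (a + J)) + -((a - b + 2 * j + 1) / (a + J)) := by
      push_cast; ring
    rw [e, Real.exp_add, ← mul_assoc]
    apply mul_le_mul (ih (by omega)) _ _ (by positivity)
    · have h1 : ((b : ℝ) - j) / (a + j + 1) = -((a - b + 2 * j + 1) / (a + j + 1)) + 1 := by
        field_simp; ring
      rw [h1]
      refine (Real.add_one_le_exp _).trans ?_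
      rw [Real.exp_le_exp, neg_le_neg_iff]
      apply div_le_div_of_nonneg_left <;> linarith
    · apply div_nonneg <;> linarith

lemma lower (a b J : ℕ) (hab : b ≤ a) (hJ : J < b) : ∀ j ≤ J,
    (a + b).choose a * Real.exp (-((j * ((a : ℝ) - b) + j ^ 2) / (b - J))) ≤
    ((a + b).choose (a + j) : ℝ) := by
  have hab' : (b : ℝ) ≤ a := by exact_mod_cast hab
  have hJ' : (J : ℝ) + 1 ≤ b := by exact_mod_cast hJ
  have hJ0 : (0 : ℝ) ≤ J := by positivity
  intro j
  induction j with
  | zero => intro _; simp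
  | succ j ih =>
    intro hj
    have hjr : (j : ℝ) + 1 ≤ J := by exact_mod_cast hj
    have hj0 : (0 : ℝ) ≤ j := by positivity
    rw [choose_step a b j (by omega)]
    have e : -((((j + 1 : ℕ) : ℝ) * ((a : ℝ) - b) + ((j + 1 : ℕ) : ℝ) ^ 2) / (b - J)) =
        -((j * ((a : ℝ) - b) + j ^ 2) / (b - J)) + -((a - b + 2 * j + 1) / (b - J)) := by
      push_cast; ring
    rw [e, Real.exp_add, ← mul_assoc]
    apply mul_le_mul (ih (by omega)) _ (by positivity) (by positivity)
    have hbj : (0 : ℝ) < b - j := by linarith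
    have h1 : ((b : ℝ) - j) / (a + j + 1) = (((a : ℝ) + j + 1) / (b - j))⁻¹ := by
      rw [inv_div]
    have h2 : ((a : ℝ) + j + 1) / (b - j) = (a - b + 2 * j + 1) / (b - j) + 1 := by
      field_simp; ring
    rw [h1, Real.exp_neg]
    apply inv_anti₀ (by apply div_pos <;> linarith)
    rw [h2]
    refine (Real.add_one_le_exp _).trans ?_
    rw [Real.exp_le_exp]
    apply div_le_div_of_nonneg_left <;> linarith

/-- Limit law for the two-color card guessing game: if `m₁ ≥ m₂`, `m₁ → ∞` and
`(m₁ - m₂)/√m₁ → ρ > 0`, then for every `z ≥ 0`,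
`P(C_{m₁,m₂} ≤ m₁ + z√m₁) → 1 - e^{-z(ρ+z)}`, i.e. `(C_{m₁,m₂}-m₁)/√m₁`
converges in distribution to the `LinExp(ρ,2)` law. -/
theorem stmt11 (m₁ m₂ : ℕ → ℕ) (ρ : ℝ) (hρ : 0 < ρ)
    (hle : ∀ k, m₂ k ≤ m₁ k)
    (hm : Filter.Tendsto (fun k => (m₁ k : ℝ)) Filter.atTop Filter.atTop)
    (hρlim : Filter.Tendsto (fun k => ((m₁ k : ℝ) - (m₂ k : ℝ)) / Real.sqrt (m₁ k))
      Filter.atTop (nhds ρ)) :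
    ∀ z : ℝ, 0 ≤ z →
      Filter.Tendsto
        (fun k => PCle (m₁ k) (m₂ k) ((m₁ k : ℝ) + z * Real.sqrt (m₁ k)))
        Filter.atTop (nhds (1 - Real.exp (-z * (ρ + z)))) := by
  intro z hz
  set s : ℕ → ℝ := fun k => Real.sqrt (m₁ k) with hs
  have hst : Filter.Tendsto s Filter.atTop Filter.atTop := Real.tendsto_sqrt_atTop.comp hm
  have hinv : Filter.Tendsto (fun k => (s k)⁻¹) Filter.atTop (nhds 0) :=
    tendsto_inv_atTop_zero.comp hst
  set j : ℕ → ℕ := fun k => ⌊z * s k⌋₊ + 1 with hj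
  have hspos : ∀ᶠ k in Filter.atTop, 0 < s k := hst.eventually_gt_atTop 0
  have hjlim : Filter.Tendsto (fun k => (j k : ℝ) / s k) Filter.atTop (nhds z) := by
    have hup : Filter.Tendsto (fun k => z + (s k)⁻¹) Filter.atTop (nhds z) := by
      simpa using hinv.const_add z
    refine tendsto_of_tendsto_of_tendsto_of_le_of_le' tendsto_const_nhds hup ?_ ?_
    · filter_upwards [hspos] with k hk
      rw [le_div_iff₀ hk]
      have := Nat.lt_floor_add_one (z * s k)
      simp only [hj]; push_cast; linarith
    · filter_upwards [hspos] with k hk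
      rw [div_le_iff₀ hk, add_mul, inv_mul_cancel₀ hk.ne']
      have := Nat.floor_le (mul_nonneg hz hk.le)
      simp only [hj]; push_cast; linarith
  have hsq : ∀ k, s k * s k = m₁ k := fun k => Real.mul_self_sqrt (by positivity)
  -- normalised quantities
  have hS : Filter.Tendsto (fun k => (j k : ℝ) / s k * (((m₁ k : ℝ) - m₂ k) / s k)
      + ((j k : ℝ) / s k) ^ 2) Filter.atTop (nhds (z * ρ + z ^ 2)) :=
    (hjlim.mul hρlim).add (hjlim.pow 2)
  have hU : Filter.Tendsto (fun k => 1 + (j k : ℝ) / s k * (s k)⁻¹)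
      Filter.atTop (nhds 1) := by
    simpa using (hjlim.mul hinv).const_add 1
  have hL : Filter.Tendsto (fun k => 1 - ((m₁ k : ℝ) - m₂ k) / s k * (s k)⁻¹
      - (j k : ℝ) / s k * (s k)⁻¹) Filter.atTop (nhds 1) := by
    simpa using ((hρlim.mul hinv).const_sub 1).sub (hjlim.mul hinv)
  have hU' := ((hS.div hU one_ne_zero).neg).rexp
  have hL' := ((hS.div hL one_ne_zero).neg).rexp
  have hev : ∀ᶠ k in Filter.atTop, j k < m₂ k := by
    filter_upwards [hspos, hL.eventually (lt_mem_nhds (show (0 : ℝ) < 1 by norm_num))] with k hk h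
    have h2 : ((m₂ k : ℝ) - j k) = (1 - ((m₁ k : ℝ) - m₂ k) / s k * (s k)⁻¹
      - (j k : ℝ) / s k * (s k)⁻¹) * (s k * s k) := by
      have := hsq k
      field_simp
      linarith
    have h3 : 0 < ((m₂ k : ℝ) - j k) := by rw [h2]; positivity
    have : (j k : ℝ) < m₂ k := by linarith
    exact_mod_cast this
  have hR : Filter.Tendsto (fun k => ((m₁ k + m₂ k).choose (m₁ k + j k) : ℝ) /
      ((m₁ k + m₂ k).choose (m₁ k) : ℝ)) Filter.atTop (nhds (Real.exp (-z * (ρ + z)))) := by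
    have e : Real.exp (-z * (ρ + z)) = Real.exp (-((z * ρ + z ^ 2) / 1)) := by
      congr 1; ring
    rw [e]
    refine tendsto_of_tendsto_of_tendsto_of_le_of_le' hL' hU' ?_ ?_
    · filter_upwards [hspos, hev] with k hk hjk
      have hc : (0 : ℝ) < ((m₁ k + m₂ k).choose (m₁ k) : ℝ) := by
        exact_mod_cast Nat.choose_pos (by omega)
      rw [le_div_iff₀' hc]
      refine le_trans (le_of_eq ?_) (lower (m₁ k) (m₂ k) (j k) (hle k) hjk (j k) le_rfl)
      congr 3
      simp only [Pi.div_apply]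
      have h1 : (1 - ((m₁ k : ℝ) - m₂ k) / s k * (s k)⁻¹ - (j k : ℝ) / s k * (s k)⁻¹)
          = ((m₂ k : ℝ) - j k) / (s k * s k) := by
        have := hsq k
        field_simp
        linarith
      have h2 : (j k : ℝ) / s k * (((m₁ k : ℝ) - m₂ k) / s k) + ((j k : ℝ) / s k) ^ 2
          = (j k * ((m₁ k : ℝ) - m₂ k) + j k ^ 2) / (s k * s k) := by
        field_simp
      rw [h1, h2, div_div_div_cancel_right₀ (by positivity)]
    · filter_upwards [hspos, hev] with k hk hjk
      have hc : (0 : ℝ) < ((m₁ k + m₂ k).choose (m₁ k) : ℝ) := by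
        exact_mod_cast Nat.choose_pos (by omega)
      rw [div_le_iff₀' hc]
      refine le_trans (upper (m₁ k) (m₂ k) (j k) (hle k) hjk (j k) le_rfl) (le_of_eq ?_)
      congr 3
      simp only [Pi.div_apply]
      have h1 : (1 + (j k : ℝ) / s k * (s k)⁻¹)
          = ((m₁ k : ℝ) + j k) / (s k * s k) := by
        have := hsq k
        field_simp
        linarith
      have h2 : (j k : ℝ) / s k * (((m₁ k : ℝ) - m₂ k) / s k) + ((j k : ℝ) / s k) ^ 2
          = (j k * ((m₁ k : ℝ) - m₂ k) + j k ^ 2) / (s k * s k) := by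
        field_simp
      rw [h1, h2, div_div_div_cancel_right₀ (by positivity)]
  refine (hR.const_sub 1).congr ?_
  intro k
  rw [PCle_eq _ _ (hle k) _ (mul_nonneg hz (Real.sqrt_nonneg _))]
end

section
/- For every real $x > 0$: $\lim_{n \to \infty} \sum_{j=0}^{n-2} \frac{\binom{n-1}{j}}{2^{n-1} - 1}\, \mathbb{P}\big(C_{n-1-j,\,j} \le \tfrac{n}{2} + x\sqrt{n}\big) = \int_0^x \sqrt{2/\pi}\; 8 t^2 e^{-2t^2}\, dt$. That is, $(C_{n-1-J_n, J_n} - n/2)/\sqrt{n}$, with $J_n$ the truncated binomial satisfying $\mathbb{P}(J_n = j) = \binom{n-1}{j}/(2^{n-1}-1)$ for $0 \le j \le n-2$ and independent of the guessing process, converges in distribution to the generalized Gamma (Maxwell–Boltzmann) random variable $G$ with density $\sqrt{2/\pi}\, 8x^2 e^{-2x^2}$, $x \ge 0$. -/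
/-- State of the reflected walk. -/
def tstat (w : List Bool) : ℕ :=
  if w.count false ≤ w.count true then w.count true - w.count false
  else w.count false - w.count true - 1

lemma tstat_le (w : List Bool) : tstat w ≤ w.length := by
  have h1 := List.count_le_length (a := true) (l := w)
  have h2 := List.count_le_length (a := false) (l := w)
  unfold tstat; split_ifs <;> omega

lemma chat_le (w : List Bool) : chat w ≤ w.length := by
  induction w with
  | nil => simp [chat]
  | cons x w ih => simp only [chat, List.length_cons]; split_ifs <;> omega

/-- indicator -/
def ind (t c : ℕ) (w : List Bool) : ℤ := if tstat w = t ∧ chat w = c then 1 else 0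

lemma step_aux (w : List Bool) : ∃ x y : Bool, (x = true ∧ y = false ∨ x = false ∧ y = true) ∧
    tstat (x :: w) = tstat w + 1 ∧ chat (x :: w) = chat w + 1 ∧
    ((tstat w = 0 ∧ tstat (y :: w) = 0 ∧ chat (y :: w) = chat w + 1) ∨
      (0 < tstat w ∧ tstat (y :: w) + 1 = tstat w ∧ chat (y :: w) = chat w)) := by
  by_cases h : w.count false ≤ w.count true
  · refine ⟨true, false, Or.inl ⟨rfl, rfl⟩, ?_⟩
    simp only [tstat, chat, List.count_cons_self, List.count_cons_of_ne, ne_eq, Bool.true_eq_false,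
      Bool.false_eq_true, not_false_eq_true, decide_eq_true_eq, decide_eq_false_iff_not]
    split_ifs <;> omega
  · refine ⟨false, true, Or.inr ⟨rfl, rfl⟩, ?_⟩
    simp only [tstat, chat, List.count_cons_self, List.count_cons_of_ne, ne_eq, Bool.true_eq_false,
      Bool.false_eq_true, not_false_eq_true, decide_eq_true_eq, decide_eq_false_iff_not]
    split_ifs <;> omega

lemma ind_succ (t c : ℕ) (w : List Bool) :
    ind t (c + 1) (true :: w) + ind t (c + 1) (false :: w)
      = ind (t - 1) c w + ind (t + 1) (c + 1) w := by
  obtain ⟨x, y, ⟨rfl, rfl⟩ | ⟨rfl, rfl⟩, h1, h2, h3⟩ := step_aux w <;>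
  · simp only [ind]
    split_ifs <;> omega

lemma ind_zero (t : ℕ) (w : List Bool) :
    ind t 0 (true :: w) + ind t 0 (false :: w) = ind (t + 1) 0 w := by
  obtain ⟨x, y, ⟨rfl, rfl⟩ | ⟨rfl, rfl⟩, h1, h2, h3⟩ := step_aux w <;>
  · simp only [ind]
    split_ifs <;> omega

lemma sum_words_succ {N : ℕ} (G : List Bool → ℤ) :
    ∑ w : Fin (N + 1) → Bool, G (List.ofFn w)
      = ∑ w : Fin N → Bool, (G (true :: List.ofFn w) + G (false :: List.ofFn w)) := by
  rw [← (Fin.consEquiv (fun _ => Bool)).sum_comp, Fintype.sum_prod_type]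
  simp [Fin.consEquiv, List.ofFn_succ, Finset.sum_add_distrib]

lemma sum_ind (N : ℕ) : ∀ t c : ℕ, ∑ w : Fin N → Bool, ind t c (List.ofFn w)
    = if t + N ≤ 2 * c then (N.choose c : ℤ) - N.choose (c + 1) else 0 := by
  induction N with
  | zero =>
    intro t c
    rcases c with _ | c
    · simp [ind, tstat, chat, eq_comm]
    · simp [ind, tstat, chat]
  | succ N ih =>
    intro t c
    rw [sum_words_succ]
    rcases c with _ | c
    · simp only [ind_zero, ih]; simp
    · simp only [ind_succ, Finset.sum_add_distrib, ih, Nat.choose_succ_succ]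
      rcases Nat.lt_or_ge (2 * (c+1)) (t + (N + 1)) with h | h
      · rw [if_neg (by omega), if_neg (by omega), if_neg (by omega)]; simp
      · by_cases h2 : t - 1 + N ≤ 2 * c
        · rw [if_pos (by omega), if_pos (by omega), if_pos (by omega)]; push_cast; ring
        · have : N = 2 * c + 1 := by omega
          have : N.choose c = N.choose (c + 1) := by
            rw [this]; exact (Nat.choose_symm_half c).symm
          rw [if_neg (by omega), if_pos (by omega), if_pos (by omega)]; push_cast
          rw [this]; ring

lemma card_chat_eq (N c : ℕ) (hc : c ≤ N) :
    ((Finset.univ.filter fun w : Fin N → Bool => chat (List.ofFn w) = c).card : ℝ)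
      = if N ≤ 2 * c then (2 * (c:ℝ) - N + 1) ^ 2 / (c + 1) * N.choose c else 0 := by
  have h1 : ((Finset.univ.filter fun w : Fin N → Bool => chat (List.ofFn w) = c).card : ℤ)
      = ∑ t ∈ Finset.range (N + 1), ∑ w : Fin N → Bool, ind t c (List.ofFn w) := by
    rw [Finset.sum_comm, Finset.card_filter]
    push_cast
    refine Finset.sum_congr rfl fun w _ => ?_
    have := tstat_le (List.ofFn w)
    simp only [List.length_ofFn] at this
    by_cases h : chat (List.ofFn w) = c
    · simp [ind, h]; omega
    · simp [ind, h]
  have h2 : ((Finset.univ.filter fun w : Fin N → Bool => chat (List.ofFn w) = c).card : ℤ)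
      = if N ≤ 2 * c then (2 * (c:ℤ) - N + 1) * ((N.choose c : ℤ) - N.choose (c + 1)) else 0 := by
    rw [h1]; simp only [sum_ind]
    rw [← Finset.sum_filter, Finset.sum_const]
    split_ifs with h
    · have : (Finset.range (N + 1)).filter (fun t => t + N ≤ 2 * c) = Finset.range (2 * c - N + 1) := by
        ext t; simp; omega
      rw [this, Finset.card_range, nsmul_eq_mul]; push_cast [Nat.cast_sub h]; rfl
    · have : (Finset.range (N + 1)).filter (fun t => t + N ≤ 2 * c) = ∅ := by
        ext t; simp; omega
      simp [this]
  have h3 : ((Finset.univ.filter fun w : Fin N → Bool => chat (List.ofFn w) = c).card : ℝ)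
      = if N ≤ 2 * c then (2 * (c:ℝ) - N + 1) * ((N.choose c : ℝ) - N.choose (c + 1)) else 0 := by
    have := congrArg (Int.cast : ℤ → ℝ) h2
    push_cast at this
    exact this
  rw [h3]
  split_ifs with h
  · have h4 : (N.choose (c + 1) : ℝ) * (c + 1) = N.choose c * (N - c) := by
      have := Nat.choose_succ_right_eq N c
      rw [← Nat.cast_sub hc]; exact_mod_cast this
    have : (0:ℝ) < c + 1 := by positivity
    field_simp
    linear_combination (-(2 * (c:ℝ) - N + 1)) * h4
  · rfl

lemma card_chat_le (N : ℕ) (s : ℝ) :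
    ((Finset.univ.filter fun w : Fin N → Bool => (chat (List.ofFn w) : ℝ) ≤ s).card : ℝ)
      = ∑ c ∈ Finset.range (N + 1),
        if N ≤ 2 * c ∧ (c : ℝ) ≤ s then (2 * (c:ℝ) - N + 1) ^ 2 / (c + 1) * N.choose c else 0 := by
  rw [Finset.card_eq_sum_card_fiberwise (f := fun w => chat (List.ofFn w)) (t := Finset.range (N + 1))]
  · push_cast
    refine Finset.sum_congr rfl fun c hc => ?_
    rw [Finset.filter_filter]
    by_cases h : (c:ℝ) ≤ s
    · have := card_chat_eq N c (by simpa [Nat.lt_succ_iff] using hc)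
      simp only [h, and_true]
      rw [← this]
      congr 2
      ext w; simp; intro hw; rw [hw]; exact h
    · simp only [h, and_false, if_false]
      rw [Finset.filter_false_of_mem]; · simp
      rintro w - ⟨h1, h2⟩; rw [h2] at h1; exact h h1
  · intro w _
    have := chat_le (List.ofFn w)
    simp at this ⊢; omega

lemma PCle_card (N m₁ m₂ : ℕ) (s : ℝ) (h : m₁ + m₂ = N) :
    (N.choose m₂ : ℝ) * PCle m₁ m₂ s =
      (Finset.univ.filter fun w : Fin N → Bool => (List.ofFn w).count true = m₁ ∧
        (chat (List.ofFn w) : ℝ) ≤ s).card := by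
  subst h
  rw [PCle, wordsWith, Finset.filter_filter, ← Nat.choose_symm_add]
  have : ((m₁ + m₂).choose m₁ : ℝ) ≠ 0 := by
    exact_mod_cast (Nat.choose_pos (by omega)).ne'
  field_simp

lemma sum_PCle (N : ℕ) (s : ℝ) :
    ∃ e : ℝ, 0 ≤ e ∧ e ≤ 1 ∧ ∑ j ∈ Finset.range N, (N.choose j : ℝ) * PCle (N - j) j s =
      ((Finset.univ.filter fun w : Fin N → Bool => (chat (List.ofFn w) : ℝ) ≤ s).card : ℝ) - e := by
  refine ⟨(Finset.univ.filter fun w : Fin N → Bool => (List.ofFn w).count true = 0 ∧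
        (chat (List.ofFn w) : ℝ) ≤ s).card, by positivity, ?_, ?_⟩
  · norm_cast
    rw [Finset.card_le_one]
    intro a ha b hb
    simp [List.count_eq_zero, List.mem_ofFn] at ha hb
    funext i
    rw [ha.1 i, hb.1 i]
  · rw [eq_sub_iff_add_eq]
    have h1 := Finset.sum_range_succ (fun j => ((Finset.univ.filter fun w : Fin N → Bool =>
        (List.ofFn w).count true = N - j ∧ (chat (List.ofFn w) : ℝ) ≤ s).card : ℝ)) N
    simp only [Nat.sub_self] at h1
    rw [Finset.sum_congr rfl fun j hj => PCle_card N (N - j) j s (by simp at hj; omega), ← h1,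
      Finset.card_eq_sum_card_fiberwise (f := fun w => N - (List.ofFn w).count true)
        (t := Finset.range (N + 1))]
    · push_cast
      refine Finset.sum_congr rfl fun c hc => ?_
      rw [Finset.filter_filter]
      congr 2
      ext w
      have := List.count_le_length (a := true) (l := List.ofFn w)
      simp at this hc ⊢
      rw [and_comm]
      refine and_congr_right fun _ => ?_
      omega
    · intro w _
      simp

open MeasureTheory ProbabilityTheory Filter Topology

/-- Rescaled position. -/
noncomputable def upos (N c : ℕ) : ℝ := (2 * (c:ℝ) - N) / Real.sqrt N

/-- Binomial weight. -/
noncomputable def bw (N c : ℕ) : ℝ := (N.choose c : ℝ) / 2 ^ N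

lemma bw_nonneg (N c : ℕ) : 0 ≤ bw N c := by unfold bw; positivity

lemma bw_sum (N : ℕ) : ∑ c ∈ Finset.range (N + 1), bw N c = 1 := by
  simp only [bw]
  rw [← Finset.sum_div]
  have := Nat.sum_range_choose N
  rw [div_eq_one_iff_eq (by positivity)]
  exact_mod_cast this

/-- Law of rescaled binomial. -/
noncomputable def blaw (N : ℕ) : Measure ℝ :=
  ∑ c ∈ Finset.range (N + 1), ENNReal.ofReal (bw N c) • Measure.dirac (upos N c)

instance (N : ℕ) : IsProbabilityMeasure (blaw N) := by
  constructor
  simp only [blaw, Measure.coe_finsetSum, Finset.sum_apply, Measure.smul_apply, measure_univ,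
    smul_eq_mul, mul_one]
  rw [← ENNReal.ofReal_sum_of_nonneg (fun _ _ => bw_nonneg _ _), bw_sum]; simp

lemma integral_blaw {E : Type*} [NormedAddCommGroup E] [NormedSpace ℝ E] [CompleteSpace E]
    (N : ℕ) (f : ℝ → E) :
    ∫ u, f u ∂(blaw N) = ∑ c ∈ Finset.range (N + 1), bw N c • f (upos N c) := by
  rw [blaw, integral_finsetSum_measure]
  · refine Finset.sum_congr rfl fun c _ => ?_
    rw [integral_smul_measure, integral_dirac, ENNReal.toReal_ofReal (bw_nonneg _ _)]
  · intro c _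
    exact (integrable_dirac (by simp)).smul_measure (by simp)

lemma charFun_blaw (N : ℕ) (t : ℝ) :
    charFun (blaw N) t = (Complex.cos ((Real.sqrt N)⁻¹ * t : ℝ)) ^ N := by
  rw [charFun_apply_real, integral_blaw, Complex.cos, add_div, add_pow]
  refine Finset.sum_congr rfl fun c hc => ?_
  have hc : c ≤ N := by simpa [Nat.lt_succ_iff] using hc
  rw [div_pow, div_pow, ← Complex.exp_nat_mul, ← Complex.exp_nat_mul]
  have h2 : (2:ℂ) ^ N = 2 ^ c * 2 ^ (N - c) := by rw [← pow_add]; congr 1; omega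
  rw [Complex.real_smul, bw]
  push_cast [h2, Nat.cast_sub hc]
  have h3 : Complex.exp (t * upos N c * Complex.I) = Complex.exp (c * (((Real.sqrt N : ℝ) : ℂ)⁻¹ * t * Complex.I)) *
      Complex.exp ((N - c) * (-(((Real.sqrt N : ℝ):ℂ)⁻¹ * t) * Complex.I)) := by
    rw [← Complex.exp_add]; congr 1
    rw [upos]; push_cast; ring
  rw [h3]; field_simp

lemma tendsto_blaw {t : ℝ} : Tendsto (fun N : ℕ => charFun (blaw N) t) atTop
    (𝓝 (charFun (gaussianReal 0 1) t)) := by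
  have h : (fun N : ℕ => charFun (blaw N) t) = fun N : ℕ =>
      (charFun (blaw 1) ((Real.sqrt N)⁻¹ * t)) ^ N := by
    funext N; rw [charFun_blaw, charFun_blaw]; simp
  rw [h]
  have := tendsto_charFun_inv_sqrt_mul_pow (P := blaw 1) (X := id) (by fun_prop)
    (by simp [integral_blaw, Finset.sum_range_succ, bw, upos]; norm_num)
    (by simp [integral_blaw, Finset.sum_range_succ, bw, upos]; norm_num) t
  simp only [Measure.map_id] at this
  rw [charFun_gaussianReal]
  convert this using 2
  simp; ring_nf

/-- The rescaled binomial law as a `ProbabilityMeasure`. -/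
noncomputable def blawP (N : ℕ) : ProbabilityMeasure ℝ := ⟨blaw N, inferInstance⟩

/-- The standard Gaussian law as a `ProbabilityMeasure`. -/
noncomputable def gaussP : ProbabilityMeasure ℝ := ⟨gaussianReal 0 1, inferInstance⟩

lemma clt_binom (h : BoundedContinuousFunction ℝ ℝ) :
    Tendsto (fun N : ℕ => ∑ c ∈ Finset.range (N + 1), bw N c * h (upos N c)) atTop
      (𝓝 (∫ u, h u ∂(gaussianReal 0 1))) := by
  have h1 : Tendsto blawP atTop (𝓝 gaussP) :=
    ProbabilityMeasure.tendsto_iff_tendsto_charFun.2 fun t => tendsto_blaw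
  have := (ProbabilityMeasure.tendsto_iff_forall_integral_tendsto.1 h1) h
  have h2 : ∀ N : ℕ, ∫ u, h u ∂(blawP N : Measure ℝ)
      = ∑ c ∈ Finset.range (N + 1), bw N c * h (upos N c) := fun N => integral_blaw N h
  simp only [h2] at this
  exact this

/-- Limit function. -/
noncomputable def Glim (a : ℝ) : ℝ :=
  ∫ u in (0:ℝ)..a, gaussianPDFReal 0 1 u * (2 * u ^ 2)

lemma Glim_cont : Continuous Glim := by
  unfold Glim
  apply intervalIntegral.continuous_primitive
  intro a b
  apply Continuous.intervalIntegrable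
  unfold gaussianPDFReal
  fun_prop

lemma Glim_eq (x : ℝ) : Glim (2 * x) = ∫ t in (0:ℝ)..x,
        Real.sqrt (2 / Real.pi) * 8 * t ^ 2 * Real.exp (-2 * t ^ 2) := by
  have := intervalIntegral.mul_integral_comp_mul_left (a := 0) (b := x)
    (f := fun u => gaussianPDFReal 0 1 u * (2 * u ^ 2)) 2
  simp only [mul_zero] at this
  rw [Glim, ← this, ← intervalIntegral.integral_const_mul]
  refine intervalIntegral.integral_congr fun t _ => ?_
  have h2 : Real.sqrt (2 / Real.pi) = 2 * (Real.sqrt (2 * Real.pi))⁻¹ := by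
    rw [Real.sqrt_eq_iff_mul_self_eq (by positivity) (by positivity)]
    have : Real.sqrt (2 * Real.pi) * Real.sqrt (2 * Real.pi) = 2 * Real.pi :=
      Real.mul_self_sqrt (by positivity)
    have hp := Real.pi_pos
    field_simp
    nlinarith
  simp only [gaussianPDFReal]
  rw [h2]
  have : Real.exp (-(2 * t - 0) ^ 2 / (2 * ((1:NNReal):ℝ))) = Real.exp (-2 * t ^ 2) := by
    congr 1; push_cast; ring
  rw [this]; push_cast; ring_nf

/-- Ramp test function. -/
noncomputable def ramp (a b u : ℝ) : ℝ :=
  2 * (max (min u b) 0) ^ 2 * (max 0 (min 1 ((b - u) / (b - a))))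

lemma ramp_one {a b u : ℝ} (hab : a < b) (h0 : 0 ≤ u) (hu : u ≤ a) : ramp a b u = 2 * u ^ 2 := by
  have : 1 ≤ (b - u) / (b - a) := by rw [le_div_iff₀ (by linarith)]; linarith
  rw [ramp, min_eq_left this, min_eq_left (by linarith), max_eq_left h0]; simp

lemma ramp_zero {a b u : ℝ} (hab : a < b) (hu : b ≤ u) : ramp a b u = 0 := by
  have : (b - u) / (b - a) ≤ 0 := div_nonpos_of_nonpos_of_nonneg (by linarith) (by linarith)
  rw [ramp, max_eq_left (a := (0:ℝ)) ((min_le_right _ _).trans this)]; simp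

lemma ramp_neg {a b u : ℝ} (hu : u ≤ 0) : ramp a b u = 0 := by
  rw [ramp, max_eq_right ((min_le_left _ _).trans hu)]; simp

lemma ramp_nonneg (a b u : ℝ) : 0 ≤ ramp a b u := by
  unfold ramp
  have : 0 ≤ max 0 (min 1 ((b - u) / (b - a))) := le_max_left _ _
  positivity

lemma ramp_le {a b u : ℝ} (h0 : 0 ≤ u) : ramp a b u ≤ 2 * u ^ 2 := by
  unfold ramp
  have h1 : 0 ≤ max 0 (min 1 ((b - u) / (b - a))) := le_max_left _ _
  have h2 : max 0 (min 1 ((b - u) / (b - a))) ≤ 1 := max_le zero_le_one (min_le_left _ _)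
  have h3 : max (min u b) 0 ≤ u := max_le (min_le_left _ _) h0
  have h4 : 0 ≤ max (min u b) 0 := le_max_right _ _
  have h5 : max (min u b) 0 ^ 2 ≤ u ^ 2 := by gcongr
  nlinarith [sq_nonneg (max (min u b) 0)]

lemma ramp_le' (a b u : ℝ) : ramp a b u ≤ 2 * b ^ 2 := by
  unfold ramp
  have h1 : 0 ≤ max 0 (min 1 ((b - u) / (b - a))) := le_max_left _ _
  have h2 : max 0 (min 1 ((b - u) / (b - a))) ≤ 1 := max_le zero_le_one (min_le_left _ _)
  have h3 : max (min u b) 0 ^ 2 ≤ b ^ 2 := by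
    rcases le_total 0 (min u b) with h | h
    · rw [max_eq_left h]; have := min_le_right u b; gcongr
    · rw [max_eq_right h]; nlinarith [sq_nonneg b]
  nlinarith [sq_nonneg (max (min u b) 0)]

/-- Bundled ramp -/
noncomputable def rampB (a b : ℝ) : BoundedContinuousFunction ℝ ℝ :=
  BoundedContinuousFunction.ofNormedAddCommGroup (ramp a b)
    (by unfold ramp; fun_prop) (2 * b ^ 2) (fun u => by
      rw [Real.norm_of_nonneg (ramp_nonneg _ _ _)]; exact ramp_le' _ _ _)

lemma Glim_indicator {a : ℝ} (ha : 0 ≤ a) :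
    Glim a = ∫ u, (Set.Ioc 0 a).indicator (fun u => 2 * u ^ 2) u ∂(gaussianReal 0 1) := by
  rw [integral_gaussianReal_eq_integral_smul (by simp), Glim, intervalIntegral.integral_of_le ha,
    ← integral_indicator measurableSet_Ioc]
  congr 1; funext u
  by_cases hu : u ∈ Set.Ioc 0 a <;> simp [hu]

lemma ind_integrable (a : ℝ) :
    Integrable ((Set.Ioc 0 a).indicator (fun u : ℝ => 2 * u ^ 2)) (gaussianReal 0 1) := by
  apply Integrable.of_bound (C := 2 * a ^ 2)
  swap
  · exact ((by fun_prop : Measurable fun u : ℝ => 2 * u ^ 2).indicator measurableSet_Ioc).aestronglyMeasurable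
  · refine ae_of_all _ fun u => ?_
    by_cases hu : u ∈ Set.Ioc 0 a
    · simp only [hu, Set.indicator_of_mem]
      rw [Real.norm_of_nonneg (by positivity)]
      have := hu.1; have := hu.2
      gcongr
    · simp only [hu, not_false_eq_true, Set.indicator_of_notMem, norm_zero]; positivity

lemma ramp_lower {a b : ℝ} (ha : 0 ≤ a) (hab : a < b) :
    Glim a ≤ ∫ u, rampB a b u ∂(gaussianReal 0 1) := by
  rw [Glim_indicator ha]
  refine integral_mono (ind_integrable a) ((rampB a b).integrable _) fun u => ?_
  change _ ≤ ramp a b u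
  by_cases hu : u ∈ Set.Ioc 0 a
  · simp only [hu, Set.indicator_of_mem]; rw [ramp_one hab hu.1.le hu.2]
  · simp only [hu, not_false_eq_true, Set.indicator_of_notMem]; exact ramp_nonneg _ _ _

lemma ramp_upper {a b : ℝ} (hb : 0 ≤ b) (hab : a < b) :
    ∫ u, rampB a b u ∂(gaussianReal 0 1) ≤ Glim b := by
  rw [Glim_indicator hb]
  refine integral_mono ((rampB a b).integrable _) (ind_integrable b) fun u => ?_
  change ramp a b u ≤ _
  by_cases hu : u ∈ Set.Ioc 0 b
  · simp only [hu, Set.indicator_of_mem]; exact ramp_le hu.1.le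
  · simp only [hu, not_false_eq_true, Set.indicator_of_notMem]
    rcases le_or_gt u 0 with h | h
    · rw [ramp_neg h]
    · rw [ramp_zero hab]; by_contra h'; exact hu ⟨h, by linarith⟩

/-- Error bound of the coefficient in the window. -/
lemma coef_bound (N c : ℕ) (hN : 1 ≤ N) (M : ℝ) (h0 : N ≤ 2 * c) (hM : upos N c ≤ M) :
    |(2 * (c:ℝ) - N + 1) ^ 2 / (c + 1) - 2 * upos N c ^ 2|
      ≤ 2 * (2 * M + M ^ 3 + 1 + 2 * M ^ 2) / Real.sqrt N := by
  have hN' : (1:ℝ) ≤ N := by exact_mod_cast hN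
  set r := Real.sqrt N with hr
  have hr1 : 1 ≤ r := by rw [hr]; exact Real.one_le_sqrt.2 hN'
  have hrr : r ^ 2 = N := Real.sq_sqrt (by positivity)
  set u := upos N c with hu
  have hcu : 2 * (c:ℝ) - N = u * r := by
    rw [hu, upos, ← hr]; field_simp
  have hu0 : 0 ≤ u := by
    rw [hu, upos]; apply div_nonneg _ (Real.sqrt_nonneg _)
    have : (N:ℝ) ≤ 2 * c := by exact_mod_cast h0
    linarith
  have hc : (c:ℝ) = (r ^ 2 + u * r) / 2 := by rw [hrr]; linarith
  rw [hcu, hc]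
  have hD : 0 < r ^ 2 + u * r + 2 := by positivity
  have e1 : (u * r + 1) ^ 2 / ((r ^ 2 + u * r) / 2 + 1) - 2 * u ^ 2
      = 2 * (2 * u * r + 1 - u ^ 3 * r - 2 * u ^ 2) / (r ^ 2 + u * r + 2) := by
    field_simp; ring
  rw [e1, abs_div, abs_of_pos hD, div_le_div_iff₀ hD (by positivity)]
  have e2 : |2 * (2 * u * r + 1 - u ^ 3 * r - 2 * u ^ 2)| ≤ 2 * (2 * u + u ^ 3 + 1 + 2 * u ^ 2) * r := by
    have h3 : 0 ≤ u ^ 3 := by positivity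
    have h2 : 0 ≤ u ^ 2 := by positivity
    rw [abs_le]; constructor <;> nlinarith [mul_nonneg hu0 (by linarith : 0 ≤ r), mul_nonneg h3 (by linarith : 0 ≤ r), mul_nonneg h2 (by linarith : 0 ≤ r - 1)]
  have e3 : 2 * (2 * u + u ^ 3 + 1 + 2 * u ^ 2) ≤ 2 * (2 * M + M ^ 3 + 1 + 2 * M ^ 2) := by gcongr
  have e4 : 0 ≤ 2 * (2 * u + u ^ 3 + 1 + 2 * u ^ 2) := by positivity
  calc _ ≤ 2 * (2 * u + u ^ 3 + 1 + 2 * u ^ 2) * r * r := by gcongr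
    _ = 2 * (2 * u + u ^ 3 + 1 + 2 * u ^ 2) * r ^ 2 := by ring
    _ ≤ 2 * (2 * M + M ^ 3 + 1 + 2 * M ^ 2) * (r ^ 2 + u * r + 2) := by
        apply mul_le_mul e3 _ (by positivity) (by linarith)
        nlinarith [mul_nonneg hu0 (by linarith : 0 ≤ r)]

/-- Main normalized sum. -/
noncomputable def msum (N : ℕ) (θ : ℝ) : ℝ :=
  ∑ c ∈ Finset.range (N + 1),
    if N ≤ 2 * c ∧ upos N c ≤ θ then (2 * (c:ℝ) - N + 1) ^ 2 / (c + 1) * bw N c else 0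

lemma upos_nonneg {N c : ℕ} (h : N ≤ 2 * c) : 0 ≤ upos N c := by
  rw [upos]; apply div_nonneg _ (Real.sqrt_nonneg _)
  have : (N:ℝ) ≤ 2 * c := by exact_mod_cast h
  linarith

lemma upos_nonpos {N c : ℕ} (h : ¬ N ≤ 2 * c) : upos N c ≤ 0 := by
  rw [upos]; apply div_nonpos_of_nonpos_of_nonneg _ (Real.sqrt_nonneg _)
  have : 2 * (c:ℝ) ≤ N := by exact_mod_cast (by omega : 2 * c ≤ N)
  linarith

lemma msum_lower (N : ℕ) (hN : 1 ≤ N) (a θ M : ℝ) (haθ : a < θ) (hM : θ ≤ M) (hM0 : 0 ≤ M) :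
    ∑ c ∈ Finset.range (N + 1), bw N c * rampB a θ (upos N c)
      ≤ msum N θ + 2 * (2 * M + M ^ 3 + 1 + 2 * M ^ 2) / Real.sqrt N := by
  set K := 2 * (2 * M + M ^ 3 + 1 + 2 * M ^ 2) / Real.sqrt N with hK
  have hK0 : 0 ≤ K := by positivity
  have : K = ∑ c ∈ Finset.range (N + 1), bw N c * K := by
    rw [← Finset.sum_mul, bw_sum, one_mul]
  rw [this, msum, ← Finset.sum_add_distrib]
  refine Finset.sum_le_sum fun c _ => ?_
  have hb := bw_nonneg N c
  change bw N c * ramp a θ (upos N c) ≤ _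
  split_ifs with h
  · have h1 := abs_le.1 (coef_bound N c hN M h.1 (h.2.trans hM))
    have h2 := ramp_le (a := a) (b := θ) (upos_nonneg h.1)
    rw [mul_comm _ (bw N c), ← mul_add]
    apply mul_le_mul_of_nonneg_left _ hb
    linarith [h1.1]
  · have : ramp a θ (upos N c) = 0 := by
      by_cases h1 : N ≤ 2 * c
      · exact ramp_zero haθ (le_of_lt (by by_contra h2; exact h ⟨h1, by linarith⟩))
      · exact ramp_neg (upos_nonpos h1)
    rw [this]; simp; positivity

lemma msum_upper (N : ℕ) (hN : 1 ≤ N) (θ b M : ℝ) (hbθ : θ < b) (hM : θ ≤ M) (hM0 : 0 ≤ M) :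
    msum N θ ≤ ∑ c ∈ Finset.range (N + 1), bw N c * rampB θ b (upos N c)
      + 2 * (2 * M + M ^ 3 + 1 + 2 * M ^ 2) / Real.sqrt N := by
  set K := 2 * (2 * M + M ^ 3 + 1 + 2 * M ^ 2) / Real.sqrt N with hK
  have hK0 : 0 ≤ K := by positivity
  have : K = ∑ c ∈ Finset.range (N + 1), bw N c * K := by
    rw [← Finset.sum_mul, bw_sum, one_mul]
  rw [this, msum, ← Finset.sum_add_distrib]
  refine Finset.sum_le_sum fun c _ => ?_
  have hb := bw_nonneg N c
  change _ ≤ bw N c * ramp θ b (upos N c) + _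
  split_ifs with h
  · have h1 := abs_le.1 (coef_bound N c hN M h.1 (h.2.trans hM))
    have h2 := ramp_one hbθ (upos_nonneg h.1) h.2
    rw [mul_comm _ (bw N c), ← mul_add]
    apply mul_le_mul_of_nonneg_left _ hb
    linarith [h1.2]
  · have := ramp_nonneg θ b (upos N c)
    positivity

lemma msum_mono (N : ℕ) {θ θ' : ℝ} (h : θ ≤ θ') : msum N θ ≤ msum N θ' := by
  refine Finset.sum_le_sum fun c _ => ?_
  have hb := bw_nonneg N c
  split_ifs with h1 h2 h2
  · exact le_rfl
  · exact absurd ⟨h1.1, h1.2.trans h⟩ h2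
  · positivity
  · exact le_rfl

lemma tendsto_K (M : ℝ) : Tendsto (fun N : ℕ =>
    2 * (2 * M + M ^ 3 + 1 + 2 * M ^ 2) / Real.sqrt N) atTop (𝓝 0) :=
  Tendsto.const_div_atTop (Real.tendsto_sqrt_atTop.comp tendsto_natCast_atTop_atTop) _

lemma msum_tendsto (y : ℝ) (hy : 0 < y) (θ : ℕ → ℝ) (hθ : Tendsto θ atTop (𝓝 y)) :
    Tendsto (fun N => msum N (θ N)) atTop (𝓝 (Glim y)) := by
  rw [tendsto_order]
  constructor
  · intro b hb
    have h1 : ∀ᶠ a in 𝓝[<] y, b < Glim a ∧ 0 < a ∧ a < y :=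
      ((Glim_cont.tendsto y).mono_left nhdsWithin_le_nhds |>.eventually (lt_mem_nhds hb)).and
        ((eventually_nhdsWithin_of_eventually_nhds (lt_mem_nhds hy)).and self_mem_nhdsWithin)
    obtain ⟨a, ha1, ha0, hay⟩ := h1.exists
    obtain ⟨a', haa', ha'y⟩ := exists_between hay
    have h2 : Tendsto (fun N : ℕ => ∑ c ∈ Finset.range (N + 1), bw N c * rampB a a' (upos N c)
        - 2 * (2 * y + y ^ 3 + 1 + 2 * y ^ 2) / Real.sqrt N) atTop
        (𝓝 (∫ u, rampB a a' u ∂(gaussianReal 0 1) - 0)) := (clt_binom _).sub (tendsto_K y)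
    have h3 : b < ∫ u, rampB a a' u ∂(gaussianReal 0 1) - 0 := by
      rw [sub_zero]; exact ha1.trans_le (ramp_lower ha0.le haa')
    filter_upwards [h2.eventually (lt_mem_nhds h3), hθ.eventually (lt_mem_nhds ha'y),
      eventually_ge_atTop 1] with N hN1 hN2 hN3
    have := msum_lower N hN3 a a' y haa' ha'y.le hy.le
    have := msum_mono N hN2.le
    linarith
  · intro b hb
    have h1 : ∀ᶠ a in 𝓝[>] y, Glim a < b ∧ y < a :=
      ((Glim_cont.tendsto y).mono_left nhdsWithin_le_nhds |>.eventually (gt_mem_nhds hb)).and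
        self_mem_nhdsWithin
    obtain ⟨a, ha1, hay⟩ := h1.exists
    obtain ⟨a', ha'y, haa'⟩ := exists_between hay
    have h2 : Tendsto (fun N : ℕ => ∑ c ∈ Finset.range (N + 1), bw N c * rampB a' a (upos N c)
        + 2 * (2 * a' + a' ^ 3 + 1 + 2 * a' ^ 2) / Real.sqrt N) atTop
        (𝓝 (∫ u, rampB a' a u ∂(gaussianReal 0 1) + 0)) := (clt_binom _).add (tendsto_K a')
    have h3 : ∫ u, rampB a' a u ∂(gaussianReal 0 1) + 0 < b := by
      rw [add_zero]; exact (ramp_upper (by linarith) haa').trans_lt ha1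
    filter_upwards [h2.eventually (gt_mem_nhds h3), hθ.eventually (gt_mem_nhds ha'y),
      eventually_ge_atTop 1] with N hN1 hN2 hN3
    have := msum_upper N hN3 a' a a' haa' le_rfl (by linarith)
    have := msum_mono N hN2.le
    linarith

lemma theta_tendsto (x : ℝ) : Tendsto (fun N : ℕ =>
    (1 + 2 * x * Real.sqrt ((N:ℝ) + 1)) / Real.sqrt N) atTop (𝓝 (2 * x)) := by
  have h1 : Tendsto (fun N : ℕ => (Real.sqrt N)⁻¹) atTop (𝓝 0) :=
    tendsto_inv_atTop_zero.comp (Real.tendsto_sqrt_atTop.comp tendsto_natCast_atTop_atTop)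
  have h2 : Tendsto (fun N : ℕ => Real.sqrt (1 + (Real.sqrt N)⁻¹ ^ 2)) atTop (𝓝 1) := by
    have := (Real.continuous_sqrt.tendsto _).comp ((h1.pow 2).const_add 1)
    simpa [Function.comp_def] using this
  have h3 : Tendsto (fun N : ℕ => (Real.sqrt N)⁻¹ + 2 * x * Real.sqrt (1 + (Real.sqrt N)⁻¹ ^ 2))
      atTop (𝓝 (0 + 2 * x * 1)) := h1.add (h2.const_mul _)
  simp only [zero_add, mul_one] at h3
  refine h3.congr' ?_
  filter_upwards [eventually_ge_atTop 1] with N hN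
  have hN' : (0:ℝ) < N := by exact_mod_cast hN
  have : Real.sqrt ((N:ℝ) + 1) = Real.sqrt N * Real.sqrt (1 + (Real.sqrt N)⁻¹ ^ 2) := by
    rw [← Real.sqrt_mul hN'.le, inv_pow, Real.sq_sqrt hN'.le]; congr 1; field_simp
  rw [this]
  have := Real.sqrt_pos.2 hN'
  field_simp

lemma card_eq_msum (N : ℕ) (hN : 1 ≤ N) (x : ℝ) :
    ((Finset.univ.filter fun w : Fin N → Bool => (chat (List.ofFn w) : ℝ) ≤
      ((N:ℝ) + 1) / 2 + x * Real.sqrt ((N:ℝ) + 1)).card : ℝ)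
      = 2 ^ N * msum N ((1 + 2 * x * Real.sqrt ((N:ℝ) + 1)) / Real.sqrt N) := by
  rw [card_chat_le, msum, Finset.mul_sum]
  refine Finset.sum_congr rfl fun c _ => ?_
  have hN' : (0:ℝ) < N := by exact_mod_cast hN
  have hs := Real.sqrt_pos.2 hN'
  have : (c:ℝ) ≤ ((N:ℝ) + 1) / 2 + x * Real.sqrt ((N:ℝ) + 1) ↔
      upos N c ≤ (1 + 2 * x * Real.sqrt ((N:ℝ) + 1)) / Real.sqrt N := by
    rw [upos, div_le_div_iff_of_pos_right hs]
    constructor <;> intro h <;> linarith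
  simp only [this, bw]
  split_ifs
  · field_simp
  · simp

theorem stmt12 (x : ℝ) (hx : 0 < x) :
    Filter.Tendsto
      (fun n : ℕ => ∑ j ∈ Finset.range (n - 1),
        (((n - 1).choose j : ℝ) / ((2 : ℝ) ^ (n - 1) - 1)) *
          PCle (n - 1 - j) j ((n : ℝ) / 2 + x * Real.sqrt n))
      Filter.atTop
      (nhds (∫ t in (0:ℝ)..x,
        Real.sqrt (2 / Real.pi) * 8 * t ^ 2 * Real.exp (-2 * t ^ 2))) := by
  rw [← Glim_eq]
  rw [← tendsto_add_atTop_iff_nat 1]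
  simp only [Nat.add_sub_cancel, Nat.cast_add, Nat.cast_one]
  choose e he0 he1 he using fun N : ℕ => sum_PCle N (((N:ℝ) + 1) / 2 + x * Real.sqrt ((N:ℝ) + 1))
  have hp : Tendsto (fun N : ℕ => ((1:ℝ) / 2) ^ N) atTop (𝓝 0) :=
    tendsto_pow_atTop_nhds_zero_of_lt_one (by norm_num) (by norm_num)
  have hep : Tendsto (fun N : ℕ => e N * ((1:ℝ) / 2) ^ N) atTop (𝓝 0) :=
    squeeze_zero (fun N => mul_nonneg (he0 N) (by positivity))
      (fun N => mul_le_of_le_one_left (by positivity) (he1 N)) hp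
  have hm := msum_tendsto (2 * x) (by linarith) _ (theta_tendsto x)
  have hT := (hm.sub hep).div (hp.const_sub 1) (by norm_num)
  simp only [sub_zero, div_one] at hT
  refine hT.congr' ?_
  filter_upwards [eventually_ge_atTop 1] with N hN
  have h1 : ∀ j, ((N.choose j : ℝ) / ((2 : ℝ) ^ N - 1)) *
      PCle (N - j) j (((N:ℝ) + 1) / 2 + x * Real.sqrt ((N:ℝ) + 1)) =
      (N.choose j : ℝ) * PCle (N - j) j (((N:ℝ) + 1) / 2 + x * Real.sqrt ((N:ℝ) + 1))
        / ((2 : ℝ) ^ N - 1) := fun j => by ring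
  simp only [h1]
  rw [← Finset.sum_div, he, card_eq_msum N hN]
  have h2 : (1:ℝ) < 2 ^ N := one_lt_pow₀ (by norm_num) (by omega)
  have h3 : (2:ℝ) ^ N - 1 ≠ 0 := by linarith
  have h4 : ((1:ℝ) / 2) ^ N = 1 / 2 ^ N := by rw [div_pow, one_pow]
  simp only [Pi.div_apply, h4]
  have h5 : 1 - 1 / (2:ℝ) ^ N = (2 ^ N - 1) / 2 ^ N := by field_simp
  rw [h5]
  field_simp
end

section
/- For every real $x$ with $0 < x < 1$: $\lim_{n \to \infty} \sum_{j=0}^{n-2} \frac{\binom{n-1}{j}}{2^{n-1}-1}\, \mathbb{P}\big(H_{n-1-j,\,j} \le x \cdot \tfrac{n}{2}\big) = \frac{2}{\pi} \arcsin\sqrt{x} = \int_0^x \frac{1}{\pi\sqrt{u(1-u)}}\, du$. That is, $H_{n-1-J_n, J_n}/(n/2)$, with $J_n$ the truncated binomial satisfying $\mathbb{P}(J_n = j) = \binom{n-1}{j}/(2^{n-1}-1)$ for $0 \le j \le n-2$ and independent of the word, converges in distribution to the Arcsine ($\beta(1/2,1/2)$) law. -/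
/-- `h w` is the largest `k ≥ 0` such that the suffix of `w` of length `2k`
contains exactly `k` letters `a` (`true`) and `k` letters `b` (`false`). -/
def h (w : List Bool) : ℕ :=
  (Finset.range (w.length + 1)).sup fun k =>
    if 2 * k ≤ w.length ∧ (w.drop (w.length - 2 * k)).count true = k then k else 0

/-- `P(H_{m₁,m₂} ≤ t)`. -/
noncomputable def PHle (m₁ m₂ : ℕ) (t : ℝ) : ℝ :=
  (((wordsWith m₁ m₂).filter fun w => (h (List.ofFn w) : ℝ) ≤ t).card : ℝ) /
    ((m₁ + m₂).choose m₁ : ℝ)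


def Bal (w : List Bool) (k : ℕ) : Prop :=
  2 * k ≤ w.length ∧ (w.drop (w.length - 2 * k)).count true = k

lemma le_h_of_bal {w : List Bool} {k : ℕ} (hb : Bal w k) : k ≤ h w := by
  unfold h
  have h1 : k ∈ Finset.range (w.length + 1) := by
    have := hb.1
    simp; omega
  have := Finset.le_sup (f := fun k =>
    if 2 * k ≤ w.length ∧ (w.drop (w.length - 2 * k)).count true = k then k else 0) h1
  simpa [if_pos (show 2 * k ≤ w.length ∧ (w.drop (w.length - 2 * k)).count true = k from hb)] using this

lemma bal_zero (w : List Bool) : Bal w 0 := by simp [Bal]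

lemma bal_h (w : List Bool) : Bal w (h w) := by
  obtain ⟨k, hk, he⟩ := Finset.exists_mem_eq_sup (Finset.range (w.length + 1)) (by simp)
    (fun k => if 2 * k ≤ w.length ∧ (w.drop (w.length - 2 * k)).count true = k then k else 0)
  have he' : h w = _ := he
  by_cases hc : 2 * k ≤ w.length ∧ (w.drop (w.length - 2 * k)).count true = k
  · simp only [if_pos hc] at he'
    rw [he']; exact hc
  · simp only [if_neg hc] at he'
    rw [he']; exact bal_zero w

lemma h_append_iff (u v : List Bool) (k : ℕ) (hv : v.length = 2 * k) :
    h (u ++ v) = k ↔ h u = 0 ∧ v.count true = k := by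
  have key : v.count true = k → ∀ s, Bal (u ++ v) (k + s) ↔ Bal u s := by
    intro hc s
    unfold Bal
    by_cases hs : 2 * s ≤ u.length
    · have e : (u ++ v).length - 2 * (k + s) = u.length - 2 * s := by simp; omega
      rw [e, List.drop_append_of_le_length (by omega), List.count_append, hc]
      simp; omega
    · simp only [List.length_append]; constructor <;> (intro hh; have := hh.1; omega)
  constructor
  · intro hk
    have hb := bal_h (u ++ v)
    rw [hk] at hb
    have hc : v.count true = k := by
      have := hb.2
      have e : (u ++ v).length - 2 * k = u.length := by simp; omega
      rw [e] at this
      simpa using this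
    refine ⟨?_, hc⟩
    have := le_h_of_bal ((key hc (h u)).2 (bal_h u))
    omega
  · rintro ⟨hu, hc⟩
    have h1 := le_h_of_bal ((key hc 0).2 (bal_zero u))
    obtain ⟨s, hs⟩ := Nat.exists_eq_add_of_le h1
    have h2 := bal_h (u ++ v)
    rw [hs] at h2
    have := le_h_of_bal ((key hc s).1 (by simpa using h2))
    omega

lemma h_cons (b : Bool) (w : List Bool) (M : ℕ) (hw : w.length = 2 * M) : h (b :: w) = h w := by
  have key : ∀ k, Bal (b :: w) k ↔ Bal w k := by
    intro k
    unfold Bal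
    by_cases hk : 2 * k ≤ w.length
    · have e : (b :: w).length - 2 * k = (w.length - 2 * k) + 1 := by simp; omega
      rw [e, List.drop_succ_cons]
      simp; omega
    · simp only [List.length_cons]; constructor <;> (intro hh; have := hh.1; omega)
  exact le_antisymm (le_h_of_bal ((key _).1 (bal_h _))) (le_h_of_bal ((key _).2 (bal_h _)))

/-- number of words of length `N` with `h = k`. -/
def cH (N k : ℕ) : ℕ := (Finset.univ.filter fun w : Fin N → Bool => h (List.ofFn w) = k).card

/-- number of words of length `N` with `h ≤ k`. -/
def cL (N k : ℕ) : ℕ := (Finset.univ.filter fun w : Fin N → Bool => h (List.ofFn w) ≤ k).card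

/-- number of words of length `N` with `k` letters true. -/
def cT (N k : ℕ) : ℕ := (Finset.univ.filter fun w : Fin N → Bool => (List.ofFn w).count true = k).card

lemma count_ofFn {N : ℕ} (w : Fin N → Bool) :
    (List.ofFn w).count true = (Finset.univ.filter fun i => w i = true).card := by
  induction N with
  | zero => simp
  | succ n ih =>
    rw [List.ofFn_succ, List.count_cons, ih, Fin.card_filter_univ_succ]
    by_cases h0 : w 0 = true <;> simp [h0]

lemma cT_eq (N k : ℕ) : cT N k = N.choose k := by
  unfold cT
  have : N.choose k = (Finset.powersetCard k (Finset.univ : Finset (Fin N))).card := by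
    simp
  rw [this]
  refine Finset.card_bij' (fun w _ => Finset.univ.filter fun i => w i = true)
    (fun s _ => fun i => decide (i ∈ s)) ?_ ?_ ?_ ?_
  · intro w hw
    simp only [Finset.mem_filter, Finset.mem_univ, true_and] at hw
    rw [count_ofFn] at hw
    simp [Finset.mem_powersetCard, hw]
  · intro s hs
    simp only [Finset.mem_powersetCard] at hs
    simp [count_ofFn, hs.2]
  · intro w _; ext i; simp
  · intro s _; ext i; simp

lemma cH_split (r k : ℕ) : cH (2 * r + 2 * k) k = cH (2 * r) 0 * k.centralBinom := by
  have : k.centralBinom = cT (2 * k) k := by rw [cT_eq]; rfl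
  rw [this]
  unfold cH cT
  rw [← Finset.card_product]
  symm
  refine Finset.card_equiv (Fin.appendEquiv (2 * r) (2 * k)) ?_
  rintro ⟨u, v⟩
  simp only [Finset.mem_product, Finset.mem_filter, Finset.mem_univ, true_and, Fin.appendEquiv,
    Equiv.coe_fn_mk, List.ofFn_fin_append]
  rw [h_append_iff _ _ k (by simp)]

lemma cL_odd (M k : ℕ) : cL (2 * M + 1) k = 2 * cL (2 * M) k := by
  unfold cL
  have : (2 : ℕ) = (Finset.univ : Finset Bool).card := by simp
  conv_rhs => arg 1; rw [this]
  rw [← Finset.card_product]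
  symm
  refine Finset.card_equiv (Fin.consEquiv (fun _ => Bool)) ?_
  rintro ⟨u, v⟩
  simp only [Finset.mem_product, Finset.mem_filter, Finset.mem_univ, true_and, Fin.consEquiv,
    Equiv.coe_fn_mk, List.ofFn_cons]
  rw [h_cons _ _ M (by simp)]

lemma h_le_half {N : ℕ} (w : Fin N → Bool) : 2 * h (List.ofFn w) ≤ N := by
  simpa using (bal_h (List.ofFn w)).1

lemma cL_eq_sum (N k : ℕ) : cL N k = ∑ i ∈ Finset.range (k + 1), cH N i := by
  unfold cL cH
  rw [Finset.card_eq_sum_card_fiberwise (f := fun w : Fin N → Bool => h (List.ofFn w))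
    (t := Finset.range (k + 1))]
  · refine Finset.sum_congr rfl fun i hi => ?_
    rw [Finset.filter_filter]
    congr 1
    ext w
    simp only [Finset.mem_range] at hi
    simp; omega
  · intro w hw
    simp at hw ⊢
    omega

lemma cL_full (M : ℕ) : cL (2 * M) M = 4 ^ M := by
  unfold cL
  rw [Finset.filter_true_of_mem]
  · simp [pow_mul]
  · intro w _
    have := h_le_half w
    omega

lemma conv_cb (n : ℕ) :
    ∑ k ∈ Finset.range (n + 1), (k.centralBinom : ℝ) * (n - k).centralBinom = 4 ^ n := by
  have sym : ∀ n : ℕ, 2 * ∑ k ∈ Finset.range (n + 1), (k : ℝ) * ((k.centralBinom : ℝ) * (n - k).centralBinom)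
      = n * ∑ k ∈ Finset.range (n + 1), (k.centralBinom : ℝ) * (n - k).centralBinom := by
    intro n
    have h1 := Finset.sum_range_reflect (fun k => (k : ℝ) * ((k.centralBinom : ℝ) * (n - k).centralBinom)) (n + 1)
    rw [two_mul]
    nth_rewrite 1 [← h1]
    rw [← Finset.sum_add_distrib, Finset.mul_sum]
    refine Finset.sum_congr rfl fun k hk => ?_
    have hk' : k ≤ n := by simpa [Nat.lt_succ_iff] using hk
    have e : n + 1 - 1 - k = n - k := by omega
    have e2 : n - (n - k) = k := by omega
    rw [e, e2, Nat.cast_sub hk']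
    ring
  induction n with
  | zero => simp
  | succ n ih =>
    have h1 := sym (n + 1)
    rw [Finset.sum_range_succ' (fun k => (k : ℝ) * ((k.centralBinom : ℝ) * (n + 1 - k).centralBinom))] at h1
    have h2 : ∑ k ∈ Finset.range (n + 1), ((k + 1 : ℕ) : ℝ) * (((k + 1).centralBinom : ℝ) * (n + 1 - (k + 1)).centralBinom)
        = 4 * ∑ k ∈ Finset.range (n + 1), (k : ℝ) * ((k.centralBinom : ℝ) * (n - k).centralBinom)
          + 2 * ∑ k ∈ Finset.range (n + 1), (k.centralBinom : ℝ) * (n - k).centralBinom := by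
      rw [Finset.mul_sum, Finset.mul_sum, ← Finset.sum_add_distrib]
      refine Finset.sum_congr rfl fun k hk => ?_
      have e : n + 1 - (k + 1) = n - k := by omega
      have := Nat.succ_mul_centralBinom_succ k
      have h3 : ((k + 1 : ℕ) : ℝ) * ((k + 1).centralBinom : ℝ) = 2 * (2 * k + 1) * k.centralBinom := by
        exact_mod_cast this
      rw [e, ← mul_assoc, h3]; ring
    rw [h2] at h1
    have h4 := sym n
    rw [ih] at h4 h1
    push_cast at h1
    have hn : (n : ℝ) + 1 ≠ 0 := by positivity
    apply mul_left_cancel₀ hn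
    rw [← h1, pow_succ]
    linear_combination 4 * h4

lemma cH_zero (r : ℕ) : cH (2 * r) 0 = r.centralBinom := by
  induction r using Nat.strong_induction_on with
  | _ r ih =>
    have h1 := cL_full r
    rw [cL_eq_sum, Finset.sum_range_succ'] at h1
    have h2 := conv_cb r
    rw [Finset.sum_range_succ'] at h2
    have h3 : ∑ k ∈ Finset.range r, cH (2 * r) (k + 1)
        = ∑ k ∈ Finset.range r, (k + 1).centralBinom * (r - (k + 1)).centralBinom := by
      refine Finset.sum_congr rfl fun k hk => ?_
      simp only [Finset.mem_range] at hk
      have e : 2 * r = 2 * (r - (k + 1)) + 2 * (k + 1) := by omega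
      rw [show cH (2 * r) (k + 1) = cH (2 * (r - (k + 1)) + 2 * (k + 1)) (k + 1) by rw [← e],
        cH_split, ih _ (by omega), mul_comm]
    have h2' : ∑ k ∈ Finset.range r, (k + 1).centralBinom * (r - (k + 1)).centralBinom
      + Nat.centralBinom 0 * (r - 0).centralBinom = 4 ^ r := by exact_mod_cast h2
    simp at h2'
    omega

lemma cH_eq (M k : ℕ) (hk : k ≤ M) : cH (2 * M) k = k.centralBinom * (M - k).centralBinom := by
  have e : 2 * M = 2 * (M - k) + 2 * k := by omega
  rw [show cH (2 * M) k = cH (2 * (M - k) + 2 * k) k by rw [← e], cH_split, cH_zero, mul_comm]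

/-- the normalized central binomial -/
noncomputable def uu (k : ℕ) : ℝ := (k.centralBinom : ℝ) / 4 ^ k

lemma uu_zero : uu 0 = 1 := by simp [uu]

lemma uu_nonneg (k : ℕ) : 0 ≤ uu k := by unfold uu; positivity

lemma uu_succ (k : ℕ) : uu (k + 1) = uu k * ((2 * k + 1) / (2 * k + 2)) := by
  have h3 : ((k + 1 : ℕ) : ℝ) * ((k + 1).centralBinom : ℝ) = 2 * (2 * k + 1) * k.centralBinom := by
    exact_mod_cast Nat.succ_mul_centralBinom_succ k
  push_cast at h3
  unfold uu
  rw [pow_succ]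
  field_simp
  linear_combination 2 * h3

lemma uu_W (k : ℕ) : uu k ^ 2 * (2 * k + 1) * Real.Wallis.W k = 1 := by
  induction k with
  | zero => simp [uu_zero, Real.Wallis.W]
  | succ k ih =>
    rw [Real.Wallis.W_succ, uu_succ]
    refine Eq.trans ?_ ih
    push_cast
    field_simp
    ring

lemma uu_le (k : ℕ) (hk : 1 ≤ k) : uu k ≤ 1 / Real.sqrt (Real.pi * k) := by
  have hk' : (1 : ℝ) ≤ k := by exact_mod_cast hk
  have hp := Real.pi_pos
  have h1 := Real.Wallis.le_W k
  have h2 := uu_W k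
  have h3 : uu k ^ 2 * (Real.pi * k) ≤ 1 := by
    rw [← h2]
    have : uu k ^ 2 * (2 * k + 1) * (((2 : ℝ) * k + 1) / (2 * k + 2) * (Real.pi / 2)) ≤
      uu k ^ 2 * (2 * k + 1) * Real.Wallis.W k := by gcongr
    refine le_trans ?_ this
    rw [mul_assoc]
    apply mul_le_mul_of_nonneg_left _ (sq_nonneg _)
    have : (2 * (k:ℝ) + 1) * (((2 : ℝ) * k + 1) / (2 * k + 2) * (Real.pi / 2)) =
      Real.pi * ((2 * k + 1) ^ 2 / (4 * k + 4)) := by field_simp; ring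
    rw [this]
    gcongr
    rw [le_div_iff₀ (by positivity)]
    nlinarith
  rw [le_div_iff₀ (by positivity)]
  refine (sq_le_sq₀ (mul_nonneg (uu_nonneg k) (Real.sqrt_nonneg _)) zero_le_one).1 ?_
  rw [mul_pow, Real.sq_sqrt (by positivity)]
  simpa using h3

lemma arccos_step (c d : ℝ) (hd : 0 < d) (h1 : -1 ≤ c - d) (h2 : c + d ≤ 1) :
    2 * d / Real.sqrt (1 - c ^ 2) ≤ Real.arccos (c - d) - Real.arccos (c + d) := by
  set A := Real.arccos (c - d) with hA
  set B := Real.arccos (c + d) with hB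
  have cA : Real.cos A = c - d := Real.cos_arccos h1 (by linarith)
  have cB : Real.cos B = c + d := Real.cos_arccos (by linarith) h2
  have hAB : B ≤ A := Real.arccos_le_arccos (by linarith)
  have hB0 : 0 ≤ B := Real.arccos_nonneg _
  have hAp : A ≤ Real.pi := Real.arccos_le_pi _
  set p := (A + B) / 2 with hp
  set e := (A - B) / 2 with he
  have eA : A = p + e := by rw [hp, he]; ring
  have eB : B = p - e := by rw [hp, he]; ring
  rw [eA, Real.cos_add] at cA
  rw [eB, Real.cos_sub] at cB
  have hs : Real.sin p * Real.sin e = d := by linarith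
  have hc : Real.cos p * Real.cos e = c := by linarith
  have he0 : 0 ≤ e := by rw [he]; linarith
  have hsp0 : 0 ≤ Real.sin p := Real.sin_nonneg_of_nonneg_of_le_pi (by linarith) (by linarith)
  have hsp : 0 < Real.sin p := by
    rcases hsp0.lt_or_eq with h | h
    · exact h
    · rw [← h] at hs; linarith
  have hle : Real.sin p ≤ Real.sqrt (1 - c ^ 2) := by
    apply Real.le_sqrt_of_sq_le
    rw [← hc]
    nlinarith [Real.sin_sq_add_cos_sq p, Real.sin_sq_add_cos_sq e, mul_nonneg (sq_nonneg (Real.cos p)) (sq_nonneg (Real.sin e))]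
  have hse := Real.sin_le he0
  have : 2 * d / Real.sqrt (1 - c ^ 2) ≤ 2 * d / Real.sin p := by gcongr
  have h3 : 2 * d / Real.sin p = 2 * Real.sin e := by rw [← hs]; field_simp
  linarith

lemma arcsin_sqrt_eq (x : ℝ) (hx0 : 0 ≤ x) (hx1 : x ≤ 1) :
    2 / Real.pi * Real.arcsin (Real.sqrt x) = Real.arccos (1 - 2 * x) / Real.pi := by
  have h0 : 0 ≤ Real.arcsin (Real.sqrt x) := Real.arcsin_nonneg.2 (Real.sqrt_nonneg x)
  have h1 : Real.arcsin (Real.sqrt x) ≤ Real.pi / 2 := Real.arcsin_le_pi_div_two _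
  have : Real.arccos (1 - 2 * x) = 2 * Real.arcsin (Real.sqrt x) := by
    have e : 1 - 2 * x = Real.cos (2 * Real.arcsin (Real.sqrt x)) := by
      rw [Real.cos_two_mul, Real.cos_sq', Real.sin_arcsin (by linarith [Real.sqrt_nonneg x]) (by
        rw [Real.sqrt_le_left zero_le_one]; simpa using hx1), Real.sq_sqrt hx0]
      ring
    rw [e, Real.arccos_cos (by linarith) (by linarith)]
  rw [this]; ring

lemma integral_part (x : ℝ) (hx0 : 0 < x) (hx1 : x < 1) :
    2 / Real.pi * Real.arcsin (Real.sqrt x)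
      = ∫ u in (0:ℝ)..x, 1 / (Real.pi * Real.sqrt (u * (1 - u))) := by
  have hcont : ContinuousOn (fun u => 2 / Real.pi * Real.arcsin (Real.sqrt u)) (Set.Icc 0 x) := by
    have := Real.continuous_arcsin
    fun_prop
  have hder : ∀ u ∈ Set.Ioo 0 x, HasDerivAt (fun u => 2 / Real.pi * Real.arcsin (Real.sqrt u))
      (1 / (Real.pi * Real.sqrt (u * (1 - u)))) u := by
    intro u hu
    have hu0 := hu.1
    have hu1 : u < 1 := hu.2.trans hx1
    have h1 := Real.hasDerivAt_sqrt hu0.ne'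
    have hs1 : Real.sqrt u < 1 := by rw [Real.sqrt_lt' one_pos]; simpa using hu1
    have h2 := (Real.hasDerivAt_arcsin (x := Real.sqrt u) (by linarith [Real.sqrt_nonneg u]) hs1.ne)
    have h3 := (h2.comp u h1).const_mul (2 / Real.pi)
    refine h3.congr_deriv ?_
    rw [Real.sq_sqrt hu0.le, Real.sqrt_mul hu0.le]
    have : 0 < Real.sqrt u := Real.sqrt_pos.2 hu0
    have : 0 < Real.sqrt (1 - u) := Real.sqrt_pos.2 (by linarith)
    have := Real.pi_pos
    field_simp
  have hInteg := intervalIntegral.integrableOn_deriv_of_nonneg hcont hder (fun u hu => by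
    have := Real.pi_pos
    positivity)
  rw [intervalIntegral.integral_eq_sub_of_hasDerivAt_of_le hx0.le hcont hder]
  · simp
  · rw [intervalIntegrable_iff_integrableOn_Ioc_of_le hx0.le]; exact hInteg

/-- number of words of length `N` with `i` letters true and `h ≤ K`. -/
def cE (N i K : ℕ) : ℕ := (Finset.univ.filter fun w : Fin N → Bool =>
  (List.ofFn w).count true = i ∧ h (List.ofFn w) ≤ K).card

lemma PHle_eq (m₁ m₂ : ℕ) (t : ℝ) (ht : 0 ≤ t) :
    ((m₁ + m₂).choose m₁ : ℝ) * PHle m₁ m₂ t = cE (m₁ + m₂) m₁ ⌊t⌋₊ := by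
  have hpos : ((m₁ + m₂).choose m₁ : ℝ) ≠ 0 := by
    have := Nat.choose_pos (Nat.le_add_right m₁ m₂)
    positivity
  unfold PHle wordsWith cE
  rw [mul_div_cancel₀ _ hpos, Finset.filter_filter]
  congr 3
  ext w
  rw [Nat.le_floor_iff ht]

lemma choose_PHle (N j : ℕ) (hj : j ≤ N) (t : ℝ) (ht : 0 ≤ t) :
    (N.choose j : ℝ) * PHle (N - j) j t = cE N (N - j) ⌊t⌋₊ := by
  have h1 := PHle_eq (N - j) j t ht
  rw [Nat.sub_add_cancel hj, Nat.choose_symm hj] at h1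
  exact h1

lemma cE_zero (N K : ℕ) : cE N 0 K = 1 := by
  have : cT N 0 = 1 := by rw [cT_eq]; simp
  rw [← this]
  unfold cE cT
  congr 1
  ext w
  simp only [Finset.mem_filter, Finset.mem_univ, true_and, and_iff_left_iff_imp]
  intro hw
  have h1 := (bal_h (List.ofFn w)).2
  have h2 := (List.drop_sublist ((List.ofFn w).length - 2 * h (List.ofFn w)) (List.ofFn w)).count_le true
  omega

lemma sum_cE (N K : ℕ) : ∑ j ∈ Finset.range N, cE N (N - j) K + 1 = cL N K := by
  have h1 : ∑ j ∈ Finset.range (N + 1), cE N (N - j) K = cL N K := by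
    have h2 := Finset.sum_range_reflect (fun i => cE N i K) (N + 1)
    simp only [Nat.add_sub_cancel] at h2
    rw [h2]
    unfold cL cE
    rw [Finset.card_eq_sum_card_fiberwise (f := fun w : Fin N → Bool => (List.ofFn w).count true)
      (t := Finset.range (N + 1))]
    · refine Finset.sum_congr rfl fun i hi => ?_
      rw [Finset.filter_filter]
      congr 1
      ext w
      simp [and_comm]
    · intro w hw
      have := List.count_le_length (a := true) (l := List.ofFn w)
      simp at this ⊢
      omega
  rw [Finset.sum_range_succ, Nat.sub_self, cE_zero] at h1
  exact h1

lemma sum_eq (N : ℕ) (t : ℝ) (ht : 0 ≤ t) :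
    ∑ j ∈ Finset.range N, ((N.choose j : ℝ) / ((2 : ℝ) ^ N - 1)) * PHle (N - j) j t
      = ((cL N ⌊t⌋₊ : ℝ) - 1) / ((2 : ℝ) ^ N - 1) := by
  rw [← sum_cE]
  push_cast
  rw [add_sub_cancel_right, Finset.sum_div]
  refine Finset.sum_congr rfl fun j hj => ?_
  rw [← choose_PHle N j (Finset.mem_range.1 hj).le t ht]
  ring

/-- partial sums of the discrete arcsine law -/
noncomputable def SS (M j : ℕ) : ℝ := ∑ k ∈ Finset.range (j + 1), uu k * uu (M - k)

lemma cL_even_eq (M j : ℕ) (hj : j ≤ M) : (cL (2 * M) j : ℝ) = 4 ^ M * SS M j := by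
  rw [cL_eq_sum, SS, Finset.mul_sum]
  push_cast
  refine Finset.sum_congr rfl fun k hk => ?_
  have hk' : k ≤ M := by have := Finset.mem_range.1 hk; omega
  rw [cH_eq M k hk', uu, uu]
  obtain ⟨r, rfl⟩ := Nat.exists_eq_add_of_le hk'
  rw [pow_add, Nat.add_sub_cancel_left]
  push_cast
  field_simp

lemma cL_eq_SS (N j : ℕ) (hj : j ≤ N / 2) : (cL N j : ℝ) / 2 ^ N = SS (N / 2) j := by
  have h4 : ∀ M : ℕ, (2 : ℝ) ^ (2 * M) = 4 ^ M := by intro M; rw [pow_mul]; norm_num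
  have hN := Nat.div_add_mod N 2
  generalize N / 2 = M at *
  rcases Nat.mod_two_eq_zero_or_one N with h0 | h0
  · rw [h0, add_zero] at hN
    subst hN
    rw [cL_even_eq M j hj, h4]
    field_simp
  · rw [h0] at hN
    subst hN
    rw [cL_odd, Nat.cast_mul, cL_even_eq M j hj, pow_succ, h4]
    push_cast
    field_simp

lemma SS_full (M : ℕ) : SS M M = 1 := by
  have h1 := cL_even_eq M M le_rfl
  rw [cL_full] at h1
  push_cast at h1
  have : (4 : ℝ) ^ M ≠ 0 := by positivity
  exact (mul_left_cancel₀ this (by rw [← h1, mul_one]))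

/-- the arcsine distribution function at `s / M`, shifted by a half -/
noncomputable def GG (M k : ℕ) : ℝ := Real.arccos (1 - 2 * (((k : ℝ) - 1 / 2) / M)) / Real.pi

lemma GG_nonneg (M k : ℕ) : 0 ≤ GG M k := div_nonneg (Real.arccos_nonneg _) Real.pi_pos.le

lemma GG_le_one (M k : ℕ) : GG M k ≤ 1 := by
  unfold GG
  rw [div_le_one Real.pi_pos]
  exact Real.arccos_le_pi _

lemma step_le (M k : ℕ) (hk : 1 ≤ k) (hkM : k + 1 ≤ M) :
    uu k * uu (M - k) ≤ GG M (k + 1) - GG M k := by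
  obtain ⟨r, rfl⟩ := Nat.exists_eq_add_of_le (show k ≤ M by omega)
  have hr : 1 ≤ r := by omega
  rw [Nat.add_sub_cancel_left]
  have hk' : (1 : ℝ) ≤ k := by exact_mod_cast hk
  have hr' : (1 : ℝ) ≤ r := by exact_mod_cast hr
  have hp := Real.pi_pos
  have hM : (0 : ℝ) < k + r := by linarith
  have h1 : uu k * uu r ≤ 1 / Real.sqrt (Real.pi * k) * (1 / Real.sqrt (Real.pi * r)) :=
    mul_le_mul (uu_le k hk) (uu_le r hr) (uu_nonneg r) (by positivity)
  have h2 := arccos_step (1 - 2 * k / (k + r)) (1 / (k + r)) (by positivity)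
    (by
      have : (2 * k + 1) / ((k : ℝ) + r) ≤ 2 := by rw [div_le_iff₀ hM]; linarith
      have e : (2 * k + 1) / ((k : ℝ) + r) = 2 * k / (k + r) + 1 / (k + r) := by ring
      linarith)
    (by
      have : 1 / ((k : ℝ) + r) ≤ 2 * k / (k + r) := by gcongr; linarith
      linarith)
  have e1 : 1 - (1 - 2 * (k : ℝ) / (k + r)) ^ 2 = (2 / (k + r)) ^ 2 * (k * r) := by
    field_simp; ring
  rw [e1, Real.sqrt_mul (by positivity), Real.sqrt_sq (by positivity)] at h2
  have e2 : 2 * (1 / ((k : ℝ) + r)) / (2 / (k + r) * Real.sqrt (k * r)) = 1 / Real.sqrt (k * r) := by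
    field_simp
  rw [e2] at h2
  have e3 : 1 / Real.sqrt (Real.pi * k) * (1 / Real.sqrt (Real.pi * r))
      = 1 / Real.sqrt (k * r) / Real.pi := by
    rw [one_div_mul_one_div, ← Real.sqrt_mul (by positivity),
      show Real.pi * k * (Real.pi * r) = Real.pi ^ 2 * (k * r) by ring,
      Real.sqrt_mul (by positivity), Real.sqrt_sq hp.le, div_div]
    congr 1; ring
  rw [e3] at h1
  refine h1.trans ?_
  unfold GG
  rw [← sub_div]
  refine div_le_div_of_nonneg_right (h2.trans (le_of_eq ?_)) hp.le
  push_cast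
  congr 2 <;> ring

lemma SS_bound (M j : ℕ) (hj : j + 1 ≤ M) : |SS M j - GG M (j + 1)| ≤ uu M := by
  have hsum : ∀ a b : ℕ, 1 ≤ a → a ≤ b → b ≤ M →
      ∑ k ∈ Finset.Ico a b, uu k * uu (M - k) ≤ GG M b - GG M a := by
    intro a b ha hab hb
    rw [← Finset.sum_Ico_sub (GG M) hab]
    refine Finset.sum_le_sum fun k hk => ?_
    rw [Finset.mem_Ico] at hk
    exact step_le M k (by omega) (by omega)
  have hup : SS M j = uu M + ∑ k ∈ Finset.Ico 1 (j + 1), uu k * uu (M - k) := by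
    rw [SS, Finset.range_eq_Ico, Finset.sum_eq_sum_Ico_succ_bot (by omega)]
    simp [uu_zero]
  have hlo : SS M j + ∑ k ∈ Finset.Ico (j + 1) M, uu k * uu (M - k) + uu M = 1 := by
    rw [← SS_full M, SS, SS, Finset.sum_range_add_sum_Ico _ hj, Finset.sum_range_succ]
    simp [uu_zero]
  have h1 := hsum 1 (j + 1) le_rfl (by omega) hj
  have h2 := hsum (j + 1) M (by omega) hj le_rfl
  have h3 := GG_nonneg M 1
  have h4 := GG_le_one M M
  rw [abs_le]
  constructor <;> linarith

lemma uu_tendsto : Filter.Tendsto uu Filter.atTop (nhds 0) := by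
  have h1 : Filter.Tendsto (fun k : ℕ => 1 / Real.sqrt (Real.pi * k)) Filter.atTop (nhds 0) := by
    simp only [one_div]
    refine Filter.Tendsto.inv_tendsto_atTop ?_
    exact Real.tendsto_sqrt_atTop.comp
      (Filter.Tendsto.const_mul_atTop Real.pi_pos tendsto_natCast_atTop_atTop)
  refine squeeze_zero' (Filter.Eventually.of_forall uu_nonneg) ?_ h1
  filter_upwards [Filter.eventually_ge_atTop 1] with k hk using uu_le k hk

lemma main_tendsto (x : ℝ) (hx0 : 0 < x) (hx1 : x < 1) :
    Filter.Tendsto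
      (fun n : ℕ => ∑ j ∈ Finset.range (n - 1),
        (((n - 1).choose j : ℝ) / ((2 : ℝ) ^ (n - 1) - 1)) *
          PHle (n - 1 - j) j (x * ((n : ℝ) / 2)))
      Filter.atTop (nhds (2 / Real.pi * Real.arcsin (Real.sqrt x))) := by
  rw [arcsin_sqrt_eq x hx0.le hx1.le]
  have hN : Filter.Tendsto (fun n : ℕ => n - 1) Filter.atTop Filter.atTop :=
    Filter.tendsto_sub_atTop_nat 1
  have hM : Filter.Tendsto (fun n : ℕ => (n - 1) / 2) Filter.atTop Filter.atTop :=
    (Nat.tendsto_div_const_atTop (by norm_num : (2 : ℕ) ≠ 0)).comp hN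
  have hbd : ∀ n : ℕ, 1 ≤ n → (n : ℝ) / 2 - 1 ≤ (((n - 1) / 2 : ℕ) : ℝ) ∧
      (((n - 1) / 2 : ℕ) : ℝ) ≤ (n : ℝ) / 2 := by
    intro n hn
    have h1 : n ≤ 2 * ((n - 1) / 2) + 2 := by omega
    have h2 : 2 * ((n - 1) / 2) ≤ n := by omega
    have h1' : (n : ℝ) ≤ 2 * (((n - 1) / 2 : ℕ) : ℝ) + 2 := by exact_mod_cast h1
    have h2' : 2 * (((n - 1) / 2 : ℕ) : ℝ) ≤ (n : ℝ) := by exact_mod_cast h2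
    constructor <;> linarith
  have hev : ∀ᶠ n : ℕ in Filter.atTop, ⌊x * ((n : ℝ) / 2)⌋₊ + 1 ≤ (n - 1) / 2 := by
    have hl : Filter.Tendsto (fun n : ℕ => (1 - x) * (n : ℝ)) Filter.atTop Filter.atTop :=
      Filter.Tendsto.const_mul_atTop (by linarith) tendsto_natCast_atTop_atTop
    filter_upwards [hl.eventually_ge_atTop 4, Filter.eventually_ge_atTop 1] with n h4 h1
    have h2 := (hbd n h1).1
    have h3 : (⌊x * ((n : ℝ) / 2)⌋₊ : ℝ) ≤ x * ((n : ℝ) / 2) := Nat.floor_le (by positivity)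
    have : ((⌊x * ((n : ℝ) / 2)⌋₊ + 1 : ℕ) : ℝ) ≤ (((n - 1) / 2 : ℕ) : ℝ) := by
      push_cast
      linarith
    exact_mod_cast this
  -- the argument converges
  have harg : Filter.Tendsto (fun n : ℕ =>
      (((⌊x * ((n : ℝ) / 2)⌋₊ + 1 : ℕ) : ℝ) - 1 / 2) / (((n - 1) / 2 : ℕ) : ℝ))
      Filter.atTop (nhds x) := by
    rw [tendsto_iff_norm_sub_tendsto_zero]
    have hz : Filter.Tendsto (fun n : ℕ => 2 / (((n - 1) / 2 : ℕ) : ℝ)) Filter.atTop (nhds 0) :=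
      (tendsto_const_div_atTop_nhds_zero_nat 2).comp hM
    refine squeeze_zero' (Filter.Eventually.of_forall fun n => norm_nonneg _) ?_ hz
    filter_upwards [hev, Filter.eventually_ge_atTop 1] with n he h1
    obtain ⟨h2, h2'⟩ := hbd n h1
    have h3 : (⌊x * ((n : ℝ) / 2)⌋₊ : ℝ) ≤ x * ((n : ℝ) / 2) := Nat.floor_le (by positivity)
    have h4 := Nat.lt_floor_add_one (x * ((n : ℝ) / 2))
    have hpos : (0 : ℝ) < (((n - 1) / 2 : ℕ) : ℝ) := by
      have : 0 < (n - 1) / 2 := by omega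
      exact_mod_cast this
    have h5 : x * ((n : ℝ) / 2 - 1) ≤ x * (((n - 1) / 2 : ℕ) : ℝ) := by gcongr
    have h6 : x * (((n - 1) / 2 : ℕ) : ℝ) ≤ x * ((n : ℝ) / 2) := by gcongr
    rw [Real.norm_eq_abs, div_sub' hpos.ne', abs_div, abs_of_pos hpos]
    refine div_le_div_of_nonneg_right ?_ hpos.le
    push_cast
    rw [abs_le]
    constructor <;> nlinarith
  have hG : Filter.Tendsto (fun n : ℕ => GG ((n - 1) / 2) (⌊x * ((n : ℝ) / 2)⌋₊ + 1))
      Filter.atTop (nhds (Real.arccos (1 - 2 * x) / Real.pi)) := by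
    unfold GG
    exact ((Real.continuous_arccos.tendsto _).comp
      (tendsto_const_nhds.sub (harg.const_mul 2))).div_const _
  have hS : Filter.Tendsto (fun n : ℕ => SS ((n - 1) / 2) ⌊x * ((n : ℝ) / 2)⌋₊)
      Filter.atTop (nhds (Real.arccos (1 - 2 * x) / Real.pi)) := by
    have hd : Filter.Tendsto (fun n : ℕ => SS ((n - 1) / 2) ⌊x * ((n : ℝ) / 2)⌋₊ -
        GG ((n - 1) / 2) (⌊x * ((n : ℝ) / 2)⌋₊ + 1)) Filter.atTop (nhds 0) := by
      refine squeeze_zero_norm' ?_ (uu_tendsto.comp hM)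
      filter_upwards [hev] with n hn
      exact SS_bound _ _ hn
    have := hd.add hG
    simpa using this
  have hq : Filter.Tendsto (fun n : ℕ => ((1 : ℝ) / 2) ^ (n - 1)) Filter.atTop (nhds 0) :=
    (tendsto_pow_atTop_nhds_zero_of_lt_one (by norm_num) (by norm_num)).comp hN
  have hfin := (hS.sub hq).div (tendsto_const_nhds (x := (1 : ℝ)).sub hq) (by norm_num)
  simp only [sub_zero, div_one] at hfin
  refine hfin.congr' ?_
  filter_upwards [hev, Filter.eventually_ge_atTop 2] with n hn h2
  rw [sum_eq (n - 1) _ (by positivity)]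
  simp only [Pi.div_apply]
  rw [← cL_eq_SS (n - 1) _ (by omega), div_pow, one_pow, ← sub_div, one_sub_div (by positivity)]
  rw [div_div_div_cancel_right₀ (by positivity)]

/-- Arcsine limit law for `H_{n-1-J_n, J_n}` with `J_n` truncated binomial:
for every `0 < x < 1`,
`∑_{j=0}^{n-2} (C(n-1,j)/(2^{n-1}-1)) P(H_{n-1-j,j} ≤ x·n/2)
  → (2/π) arcsin √x = ∫_0^x du/(π√(u(1-u)))`. -/
theorem stmt18 (x : ℝ) (hx0 : 0 < x) (hx1 : x < 1) :
    Filter.Tendsto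
      (fun n : ℕ => ∑ j ∈ Finset.range (n - 1),
        (((n - 1).choose j : ℝ) / ((2 : ℝ) ^ (n - 1) - 1)) *
          PHle (n - 1 - j) j (x * ((n : ℝ) / 2)))
      Filter.atTop (nhds (2 / Real.pi * Real.arcsin (Real.sqrt x))) ∧
    2 / Real.pi * Real.arcsin (Real.sqrt x)
      = ∫ u in (0:ℝ)..x, 1 / (Real.pi * Real.sqrt (u * (1 - u))) := by
  exact ⟨main_tendsto x hx0 hx1, integral_part x hx0 hx1⟩
end
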